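/- Suppose B ⊊ DK(A) and f(Z,T) is a line in k[Z,T], i.e., k[Z,T]/(f) ≅ k^{[1]}. Then k[Z,T] = k[f]^{[1]}, i.e., f is a coordinate of k[Z,T]. -/

import Mathlib

/-!
Common definitions: exponential maps, the Derksen and Makar-Limanov invariants,
𝔸ⁿ-fibrations, and the ring
`A = k[X_1,…,X_m,Y,Z,T]/(X_1^{r_1}⋯X_m^{r_m}·Y − F(X_1,…,X_m,Z,T))`.
-/

noncomputable section
open MvPolynomial

/-- An exponential map on a `k`-algebra `D`: a `k`-algebra homomorphism `φ : D → D[U]`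
such that evaluating `U` at `0` gives the identity of `D`, and such that
`φ_V ∘ φ_U = φ_{U+V}` in `D[U,V]` (where `φ_V : D[U] → D[U,V]` extends `φ` with
`φ_V(U) = U`).  Here `D[U,V]` is modelled as `Polynomial (Polynomial D)`, with inner
variable `U` and outer variable `V`. -/
structure ExpMap (k D : Type) [CommRing k] [CommRing D] [Algebra k D] where
  toAlgHom : D →ₐ[k] Polynomial D
  eval_zero : ∀ d, Polynomial.eval 0 (toAlgHom d) = d
  comp_add : ∀ d,
    Polynomial.eval₂ ((Polynomial.mapRingHom (Polynomial.C (R := D))).comp toAlgHom.toRingHom)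
      (Polynomial.C Polynomial.X) (toAlgHom d)
    = Polynomial.eval₂ ((Polynomial.C (R := Polynomial D)).comp (Polynomial.C (R := D)))
      (Polynomial.C Polynomial.X + Polynomial.X) (toAlgHom d)

namespace ExpMap
variable {k D : Type} [CommRing k] [CommRing D] [Algebra k D]

/-- The ring of invariants `D^φ = {d ∈ D | φ(d) = d}` of an exponential map. -/
def invariants (φ : ExpMap k D) : Subalgebra k D where
  carrier := {d | φ.toAlgHom d = Polynomial.C d}
  mul_mem' := fun ha hb => by
    simp only [Set.mem_setOf_eq] at *
    rw [map_mul, ha, hb, ← map_mul]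
  add_mem' := fun ha hb => by
    simp only [Set.mem_setOf_eq] at *
    rw [map_add, ha, hb, ← map_add]
  algebraMap_mem' := fun c => by
    simp only [Set.mem_setOf_eq, AlgHom.commutes, Polynomial.algebraMap_apply]

end ExpMap

/-- The Derksen invariant `DK(D)`: the `k`-subalgebra of `D` generated by the rings of
invariants of all non-trivial exponential maps on `D`. -/
def Derksen (k D : Type) [CommRing k] [CommRing D] [Algebra k D] : Subalgebra k D :=
  Algebra.adjoin k (⋃ φ ∈ {ψ : ExpMap k D | ψ.invariants ≠ ⊤}, (φ.invariants : Set D))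

/-- The Makar-Limanov invariant `ML(D)`: the intersection of the rings of invariants of
all exponential maps on `D`. -/
def MakarLimanov (k D : Type) [CommRing k] [CommRing D] [Algebra k D] : Subalgebra k D :=
  ⨅ φ : ExpMap k D, φ.invariants

/-- `D` is an `𝔸ⁿ`-fibration over `R`: a finitely generated flat `R`-algebra all of whose
fibres `D ⊗_R κ(p)` over primes `p` of `R` are polynomial rings `κ(p)^{[n]}`. -/
def IsAnFibration (R D : Type) [CommRing R] [CommRing D] [Algebra R D] (n : ℕ) : Prop :=
  Algebra.FiniteType R D ∧ Module.Flat R D ∧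
  ∀ p : PrimeSpectrum R,
    Nonempty ((TensorProduct R (IsLocalRing.ResidueField (Localization.AtPrime p.asIdeal)) D)
      ≃ₐ[IsLocalRing.ResidueField (Localization.AtPrime p.asIdeal)]
      MvPolynomial (Fin n) (IsLocalRing.ResidueField (Localization.AtPrime p.asIdeal)))

/-- The polynomial ring `k[X_1,…,X_m,Y,Z,T]`:
variables `Sum.inl i` are the `X i`; `Sum.inr 0 = Y`, `Sum.inr 1 = Z`, `Sum.inr 2 = T`. -/
abbrev BigP (k : Type) [CommRing k] (m : ℕ) := MvPolynomial (Fin m ⊕ Fin 3) k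

/-- The inclusion `k[X_1,…,X_m,Z,T] → k[X_1,…,X_m,Y,Z,T]` (in the source,
`Sum.inr 0 = Z` and `Sum.inr 1 = T`). -/
def incl (k : Type) [CommRing k] (m : ℕ) : MvPolynomial (Fin m ⊕ Fin 2) k →ₐ[k] BigP k m :=
  rename (Sum.map id Fin.succ)

/-- The polynomial `G = X_1^{r_1}⋯X_m^{r_m}·Y − F(X_1,…,X_m,Z,T)`. -/
def relG (k : Type) [CommRing k] (m : ℕ) (r : Fin m → ℕ) (F : MvPolynomial (Fin m ⊕ Fin 2) k) :
    BigP k m :=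
  (∏ i, X (Sum.inl i) ^ r i) * X (Sum.inr 0) - incl k m F

/-- The ring `A = k[X_1,…,X_m,Y,Z,T]/(X_1^{r_1}⋯X_m^{r_m}·Y − F(X_1,…,X_m,Z,T))`. -/
abbrev RingA (k : Type) [CommRing k] (m : ℕ) (r : Fin m → ℕ)
    (F : MvPolynomial (Fin m ⊕ Fin 2) k) :=
  BigP k m ⧸ Ideal.span {relG k m r F}

variable (k : Type) [CommRing k] (m : ℕ) (r : Fin m → ℕ) (F : MvPolynomial (Fin m ⊕ Fin 2) k)

/-- `x i`, the image of `X i` in `A`. -/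
def xA (i : Fin m) : RingA k m r F := Ideal.Quotient.mk _ (X (Sum.inl i))
/-- `y`, the image of `Y` in `A`. -/
def yA : RingA k m r F := Ideal.Quotient.mk _ (X (Sum.inr 0))
/-- `z`, the image of `Z` in `A`. -/
def zA : RingA k m r F := Ideal.Quotient.mk _ (X (Sum.inr 1))
/-- `t`, the image of `T` in `A`. -/
def tA : RingA k m r F := Ideal.Quotient.mk _ (X (Sum.inr 2))

/-- `f(Z,T) := F(0,…,0,Z,T) ∈ k[Z,T]`. -/
def fOf : MvPolynomial (Fin 2) k :=
  aeval (Sum.elim (fun _ => (0 : MvPolynomial (Fin 2) k)) X) F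

/-- The subalgebra `E = k[x_1,…,x_m]` of `A`. -/
def EA : Subalgebra k (RingA k m r F) := Algebra.adjoin k (Set.range (xA k m r F))

/-- The subalgebra `B = k[x_1,…,x_m,z,t]` of `A`. -/
def BA : Subalgebra k (RingA k m r F) :=
  Algebra.adjoin k (Set.range (xA k m r F) ∪ {zA k m r F, tA k m r F})

/-- If `(1 + W)^n` has no terms of degree strictly between `0` and `n`, and `(1 + W)^M` has no
terms of degree strictly between `0` and `n`, then `n ∣ M`. -/
theorem dvd_of_choose_eq_zero {P : Type*} [CommRing P] [Nontrivial P] {n M : ℕ} (hn : 0 < n)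
    (h₁ : ∀ l, 0 < l → l < n → (n.choose l : P) = 0)
    (h₂ : ∀ l, 0 < l → l < n → (M.choose l : P) = 0) : n ∣ M := by
  have hpow : (Polynomial.X + 1 : Polynomial P) ^ n = Polynomial.X ^ n + 1 := by
    ext l
    rw [Polynomial.coeff_X_add_one_pow]
    simp only [Polynomial.coeff_add, Polynomial.coeff_X_pow, Polynomial.coeff_one]
    rcases Nat.eq_zero_or_pos l with rfl | hl
    · simp [hn.ne]
    rcases lt_trichotomy l n with h | rfl | h
    · rw [h₁ l hl h, if_neg h.ne, if_neg hl.ne']; simp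
    · simp [hn.ne']
    · rw [Nat.choose_eq_zero_of_lt h, if_neg h.ne', if_neg hl.ne']; simp
  by_contra hdvd
  have hl : 0 < M % n := Nat.pos_of_ne_zero fun h => hdvd (Nat.dvd_of_mod_eq_zero h)
  have hln : M % n < n := Nat.mod_lt _ hn
  obtain ⟨g, hg⟩ : (Polynomial.X ^ n : Polynomial P) ∣ (Polynomial.X ^ n + 1) ^ (M / n) - 1 := by
    have h := sub_dvd_pow_sub_pow (Polynomial.X ^ n + 1 : Polynomial P) 1 (M / n)
    rwa [add_sub_cancel_right, one_pow] at h
  have key : (Polynomial.X + 1 : Polynomial P) ^ M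
      = (Polynomial.X + 1) ^ (M % n)
        + Polynomial.X ^ n * ((Polynomial.X + 1) ^ (M % n) * g) := by
    conv_lhs => rw [← Nat.mod_add_div M n, pow_add, pow_mul, hpow]
    rw [sub_eq_iff_eq_add.mp hg]; ring
  have := congrArg (fun p => Polynomial.coeff p (M % n)) key
  simp only [Polynomial.coeff_X_add_one_pow, Polynomial.coeff_add,
    Polynomial.coeff_X_pow_mul', if_neg (not_le.mpr hln), h₂ _ hl hln] at this
  simp at this

/-- Factors of a nonzero polynomial of degree zero have degree zero. -/
theorem natDegree_eq_zero_of_dvd_of_natDegree_eq_zero {P : Type*} [CommRing P] [IsDomain P]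
    {p q : Polynomial P} (h : p ∣ q) (hq : q ≠ 0) (hq' : q.natDegree = 0) : p.natDegree = 0 :=
  Nat.le_zero.mp (hq' ▸ Polynomial.natDegree_le_of_dvd h hq)

theorem weight_pair (a b : ℕ) (d : Fin 2 →₀ ℕ) :
    Finsupp.weight ![a, b] d = d 0 * a + d 1 * b := by
  simp [Finsupp.weight_apply, Finsupp.sum_fintype, Fin.sum_univ_two]

section BinomialDivision
variable {k : Type} [Field k] {a b : ℕ}

/-- Division of a monomial by `Z ^ b - c T ^ a`. -/
theorem monomial_div_binomial (c : k) (i : ℕ) : ∀ t j : ℕ, ∃ h : MvPolynomial (Fin 2) k,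
    X 0 ^ (i + b * t) * X 1 ^ j
      = (X 0 ^ b - C c * X 1 ^ a) * h + C (c ^ t) * (X 0 ^ i * X 1 ^ (j + a * t)) ∧
    ∀ d, coeff d h ≠ 0 → Finsupp.weight ![a, b] d + a * b = (i + b * t) * a + j * b
  | 0, j => ⟨0, by simp, by simp⟩
  | t + 1, j => by
    obtain ⟨h, h₁, h₂⟩ := monomial_div_binomial c i t (j + a)
    refine ⟨X 0 ^ (i + b * t) * X 1 ^ j + C c * h, ?_, fun d hd => ?_⟩
    · have e₁ : i + b * (t + 1) = (i + b * t) + b := by ring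
      have e₂ : j + a * (t + 1) = j + a + a * t := by ring
      rw [e₁, e₂, pow_succ c, C_mul]
      linear_combination (C c) * h₁
    · rw [coeff_add, coeff_C_mul] at hd
      by_cases hd' : coeff d h = 0
      · rw [hd', mul_zero, add_zero] at hd
        have hm : (X 0 ^ (i + b * t) * X 1 ^ j : MvPolynomial (Fin 2) k)
            = monomial (Finsupp.single 0 (i + b * t) + Finsupp.single 1 j) 1 := by
          rw [X_pow_eq_monomial, X_pow_eq_monomial, monomial_mul, one_mul]
        rw [hm, coeff_monomial] at hd
        obtain rfl := by_contra fun h => hd (if_neg h)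
        rw [weight_pair]
        simp
        ring
      · rw [h₂ d hd']; ring

/-- Division of a weighted homogeneous polynomial by `Z ^ b - c T ^ a`. -/
theorem exists_eq_binomial_mul_add (c : k) (hb : 0 < b) (hab : a.Coprime b)
    {g : MvPolynomial (Fin 2) k} {N : ℕ} (hg : IsWeightedHomogeneous ![a, b] g N) :
    ∃ (h : MvPolynomial (Fin 2) k) (κ : k) (i j : ℕ),
      g = (X 0 ^ b - C c * X 1 ^ a) * h + C κ * (X 0 ^ i * X 1 ^ j) ∧
      (κ ≠ 0 → i * a + j * b = N) ∧
      ∀ d, coeff d h ≠ 0 → Finsupp.weight ![a, b] d + a * b = N := by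
  by_cases hg0 : g = 0
  · exact ⟨0, 0, 0, 0, by simp [hg0], by simp, by simp⟩
  obtain ⟨d₀, hd₀⟩ := support_nonempty.mpr hg0
  have hw : ∀ d ∈ g.support, d 0 * a + d 1 * b = N := fun d hd => by
    rw [← weight_pair]; exact hg (mem_support_iff.mp hd)
  set i := d₀ 0 % b with hi
  set j := d₀ 1 + a * (d₀ 0 / b) with hj
  have hij : i * a + j * b = N := by
    rw [← hw d₀ hd₀, hi, hj]
    conv_rhs => rw [← Nat.mod_add_div (d₀ 0) b]
    ring
  have hmon : ∀ d ∈ g.support, ∃ h : MvPolynomial (Fin 2) k, ∃ κ : k,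
      monomial d (coeff d g) = (X 0 ^ b - C c * X 1 ^ a) * h + C κ * (X 0 ^ i * X 1 ^ j) ∧
      ∀ d', coeff d' h ≠ 0 → Finsupp.weight ![a, b] d' + a * b = N := by
    intro d hd
    have hdi : d 0 % b = i := by
      have h1 : a * d 0 ≡ a * d₀ 0 [MOD b] := by
        have h2 := (hw d hd).trans (hw d₀ hd₀).symm
        have h3 : (d 0 * a + d 1 * b) % b = (d₀ 0 * a + d₀ 1 * b) % b := by rw [h2]
        simpa [Nat.ModEq, Nat.add_mul_mod_self_right, mul_comm] using h3
      exact Nat.ModEq.cancel_left_of_coprime (Nat.Coprime.gcd_eq_one hab.symm) h1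
    have hdd : i + b * (d 0 / b) = d 0 := by rw [← hdi]; exact Nat.mod_add_div _ _
    have hdj : d 1 + a * (d 0 / b) = j := by
      have := hw d hd
      rw [← hij, ← hdd] at this
      have h4 : (d 1 + a * (d 0 / b)) * b = j * b := by
        linear_combination this
      exact Nat.eq_of_mul_eq_mul_right hb h4
    obtain ⟨h, h₁, h₂⟩ := monomial_div_binomial (a := a) (b := b) c i (d 0 / b) (d 1)
    rw [hdd, hdj] at h₁
    refine ⟨C (coeff d g) * h, coeff d g * c ^ (d 0 / b), ?_, fun d' hd' => ?_⟩
    · have : monomial d (coeff d g) = C (coeff d g) * (X 0 ^ d 0 * X 1 ^ d 1) := by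
        rw [monomial_eq, Finsupp.prod_fintype _ _ (fun _ => pow_zero _), Fin.prod_univ_two]
      rw [this, h₁, C_mul]; ring
    · rw [coeff_C_mul] at hd'
      rw [h₂ d' (right_ne_zero_of_mul hd'), hdd, hw d hd]
  choose! h κ h₁ h₂ using hmon
  refine ⟨∑ d ∈ g.support, h d, ∑ d ∈ g.support, κ d, i, j, ?_, fun _ => hij, fun d' hd' => ?_⟩
  · conv_lhs => rw [g.as_sum]
    rw [Finset.sum_congr rfl h₁, Finset.sum_add_distrib, Finset.mul_sum, map_sum, Finset.sum_mul]
  · rw [coeff_sum] at hd'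
    obtain ⟨d, hd, hne⟩ := Finset.exists_ne_zero_of_sum_ne_zero hd'
    exact h₂ d hd d' hne

end BinomialDivision

/-- The weight of `x ^ i * y ^ j * g`, where `x l` has weight `-θ l`, `g` has weight `N`, and
`x ^ r * y` has weight `wf`. -/
def monWeight {m : ℕ} (r : Fin m → ℕ) (wf : ℕ) (θ : Fin m → ℝ) (i : Fin m → ℕ) (j N : ℕ) : ℝ :=
  -∑ l, (i l : ℝ) * θ l + j * (wf + ∑ l, (r l : ℝ) * θ l) + N

section MonWeight
variable {m : ℕ} {r : Fin m → ℕ} {wf : ℕ} {θ : Fin m → ℝ}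

theorem monWeight_add (i i' : Fin m → ℕ) (j j' N N' : ℕ) :
    monWeight r wf θ (i + i') (j + j') (N + N')
      = monWeight r wf θ i j N + monWeight r wf θ i' j' N' := by
  simp only [monWeight, Pi.add_apply, Nat.cast_add, add_mul, Finset.sum_add_distrib]
  ring

theorem monWeight_nsmul (n : ℕ) (i : Fin m → ℕ) (j N : ℕ) :
    monWeight r wf θ (n • i) (n * j) (n * N) = n * monWeight r wf θ i j N := by
  simp only [monWeight, Pi.smul_apply, smul_eq_mul, Nat.cast_mul, mul_assoc, ← Finset.mul_sum]
  ring

theorem monWeight_zero (N : ℕ) : monWeight r wf θ 0 0 N = N := by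
  simp [monWeight]

theorem monWeight_single (l : Fin m) : monWeight r wf θ (Pi.single l 1) 0 0 = -θ l := by
  have : ∀ x, ((Pi.single l 1 : Fin m → ℕ) x : ℝ) * θ x = if x = l then θ x else 0 := by
    intro x
    by_cases h : x = l
    · subst h; simp
    · simp [h]
  simp [monWeight, this]

theorem eq_of_monWeight_eq (hθ : ∀ (c : Fin m → ℤ) (e : ℤ), ∑ l, (c l : ℝ) * θ l = e → c = 0)
    {i i' : Fin m → ℕ} {j j' N N' : ℕ}
    (h : monWeight r wf θ i j N = monWeight r wf θ i' j' N') :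
    (∀ l, i l + j' * r l = i' l + j * r l) ∧ N + j * wf = N' + j' * wf := by
  have h1 : ∑ l, (((i l + j' * r l : ℤ) - (i' l + j * r l) : ℤ) : ℝ) * θ l
      = ((N + j * wf - (N' + j' * wf) : ℤ) : ℝ) := by
    have : ∀ l, (((i l + j' * r l : ℤ) - (i' l + j * r l) : ℤ) : ℝ) * θ l
      = i l * θ l + j' * (r l * θ l) - (i' l * θ l + j * (r l * θ l)) := fun l => by
        push_cast; ring
    simp only [this, Finset.sum_sub_distrib, Finset.sum_add_distrib, ← Finset.mul_sum]
    simp only [monWeight] at h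
    push_cast
    linear_combination -h
  have h2 := hθ _ _ h1
  refine ⟨fun l => ?_, ?_⟩
  · have := congrFun h2 l
    simp only [Pi.zero_apply] at this
    zify; linarith
  · simp only [funext_iff, Pi.zero_apply] at h2
    simp only [h2, Int.cast_zero, zero_mul, Finset.sum_const_zero] at h1
    have := Int.cast_eq_zero.mp h1.symm
    zify; linarith

end MonWeight

/-- The associated graded data of an exponential map on `k[x, y, z, t] / (x ^ r * y - F)`:
`piece γ` collects the leading parts of the images of elements of weight `γ`. -/
structure GradedExp (k P : Type) [Field k] [CommRing P] [Algebra k P] {m : ℕ}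
    (r : Fin m → ℕ) (a b wf : ℕ) (θ : Fin m → ℝ) (f : MvPolynomial (Fin 2) k) where
  shift : ℝ
  piece : ℝ → AddSubgroup (Polynomial P)
  xs : Fin m → Polynomial P
  y : Polynomial P
  ev : MvPolynomial (Fin 2) k →ₐ[k] Polynomial P
  ev_injective : Function.Injective ev
  one_mem : 1 ∈ piece 0
  mul_mem : ∀ {γ γ' M M'}, M ∈ piece γ → M' ∈ piece γ' → M * M' ∈ piece (γ + γ')
  hasse : ∀ {γ M}, M ∈ piece γ → ∀ n : ℕ, ∃ M' ∈ piece (γ + n * shift),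
    ∀ l, M'.coeff l = ((n + l).choose l : P) * M.coeff (n + l)
  normal : ∀ {γ M}, M ∈ piece γ → M ≠ 0 → ∃ i j N g, IsWeightedHomogeneous ![a, b] g N ∧
    γ = monWeight r wf θ i j N ∧ M = (∏ l, xs l ^ i l) * y ^ j * ev g
  xs_mem : ∀ l, xs l ∈ piece (-θ l)
  ev_mem : ∀ {N : ℕ} {g}, IsWeightedHomogeneous ![a, b] g N → ev g ∈ piece N
  rel : (∏ l, xs l ^ r l) * y = ev f
  natDegree_y : y.natDegree = 0
  nontriv : ∃ γ, ∃ M ∈ piece γ, M.natDegree ≠ 0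

namespace GradedExp
variable {k P : Type} [Field k] [CommRing P] [Algebra k P] {m : ℕ}
  {r : Fin m → ℕ} {a b wf : ℕ} {θ : Fin m → ℝ} {f : MvPolynomial (Fin 2) k}
  (E : GradedExp k P r a b wf θ f)

theorem pow_mem {γ M} (h : M ∈ E.piece γ) (n : ℕ) : M ^ n ∈ E.piece (n * γ) := by
  induction n with
  | zero => simpa using E.one_mem
  | succ n ih =>
    have := E.mul_mem ih h
    rwa [← pow_succ, show (n : ℝ) * γ + γ = ((n + 1 : ℕ) : ℝ) * γ by push_cast; ring] at this

theorem C_leadingCoeff_mem {γ M} (h : M ∈ E.piece γ) :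
    Polynomial.C M.leadingCoeff ∈ E.piece (γ + M.natDegree * E.shift) := by
  obtain ⟨M', hM', hc⟩ := E.hasse h M.natDegree
  convert hM'
  ext l
  rw [hc, Polynomial.coeff_C]
  split_ifs with hl
  · subst hl; simp
  · rw [Polynomial.coeff_eq_zero_of_natDegree_lt (by omega), mul_zero]

theorem ev_ne_zero {g} (hg : g ≠ 0) : E.ev g ≠ 0 :=
  (map_ne_zero_iff _ E.ev_injective).mpr hg

theorem xs_ne_zero (hf : f ≠ 0) (hr : ∀ l, 1 < r l) (l : Fin m) : E.xs l ≠ 0 := by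
  have h := E.ev_ne_zero hf
  rw [← E.rel] at h
  intro h0
  refine left_ne_zero_of_mul h (Finset.prod_eq_zero (Finset.mem_univ l) ?_)
  rw [h0, zero_pow (by have := hr l; omega)]

theorem y_ne_zero (hf : f ≠ 0) : E.y ≠ 0 := by
  have h := E.ev_ne_zero hf
  rw [← E.rel] at h
  exact right_ne_zero_of_mul h

section Domain
variable [IsDomain P]

theorem natDegree_mon (hf : f ≠ 0) (hr : ∀ l, 1 < r l) (i : Fin m → ℕ) (j : ℕ) {g} (hg : g ≠ 0) :
    ((∏ l, E.xs l ^ i l) * E.y ^ j * E.ev g).natDegree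
      = ∑ l, i l * (E.xs l).natDegree + (E.ev g).natDegree := by
  have hx : ∀ l, E.xs l ^ i l ≠ 0 := fun l => pow_ne_zero _ (E.xs_ne_zero hf hr l)
  have hx' := Finset.prod_ne_zero_iff.mpr fun l (_ : l ∈ Finset.univ) => hx l
  have hy := pow_ne_zero j (E.y_ne_zero hf)
  rw [Polynomial.natDegree_mul (mul_ne_zero hx' hy) (E.ev_ne_zero hg),
    Polynomial.natDegree_mul hx' hy, Polynomial.natDegree_prod _ _ fun l _ => hx l]
  simp [Polynomial.natDegree_pow, E.natDegree_y]

/-- Comparison of two equal monomials of the same weight. -/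
theorem eq_of_mon_eq (hf : f ≠ 0) (hr : ∀ l, 1 < r l) {i i' : Fin m → ℕ} {j j' : ℕ} {g g'}
    (hi : ∀ l, i l + j' * r l = i' l + j * r l) (hj : j ≤ j')
    (h : (∏ l, E.xs l ^ i l) * E.y ^ j * E.ev g = (∏ l, E.xs l ^ i' l) * E.y ^ j' * E.ev g') :
    g = f ^ (j' - j) * g' := by
  obtain ⟨t, rfl⟩ := Nat.exists_eq_add_of_le hj
  have hi' : ∀ l, i' l = i l + r l * t := fun l => by
    have := hi l
    rw [add_mul] at this
    linarith [mul_comm t (r l)]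
  apply E.ev_injective
  rw [add_tsub_cancel_left, map_mul, map_pow, ← E.rel]
  have hx' := Finset.prod_ne_zero_iff.mpr fun l (_ : l ∈ Finset.univ) =>
    pow_ne_zero (i l) (E.xs_ne_zero hf hr l)
  refine mul_left_cancel₀ (mul_ne_zero hx' (pow_ne_zero j (E.y_ne_zero hf))) (h.trans ?_)
  simp only [hi', pow_add, pow_mul, Finset.prod_mul_distrib, Finset.prod_pow, mul_pow]
  ring

/-- There is a nonconstant homogeneous element of least degree, which is one of the `xs l` or of
the form `ev g`. -/
theorem exists_min (hf : f ≠ 0) (hr : ∀ l, 1 < r l) : ∃ σ, ∃ s ∈ E.piece σ, s.natDegree ≠ 0 ∧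
    (∀ γ, ∀ d ∈ E.piece γ, d.natDegree ≠ 0 → s.natDegree ≤ d.natDegree) ∧
    ((∃ l, σ = -θ l ∧ s = E.xs l) ∨
      ∃ (N : ℕ) (g : _), IsWeightedHomogeneous ![a, b] g N ∧ σ = N ∧ s = E.ev g) := by
  classical
  have hex : ∃ n : ℕ, n ≠ 0 ∧ ∃ γ, ∃ M ∈ E.piece γ, M.natDegree = n := by
    obtain ⟨γ, M, hM, h⟩ := E.nontriv
    exact ⟨_, h, γ, M, hM, rfl⟩
  obtain ⟨hn0, γ, M, hM, hMn⟩ := Nat.find_spec hex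
  have hmin : ∀ γ, ∀ d ∈ E.piece γ, d.natDegree ≠ 0 → Nat.find hex ≤ d.natDegree :=
    fun γ d hd h => Nat.find_min' hex ⟨h, γ, d, hd, rfl⟩
  set n := Nat.find hex
  have hM0 : M ≠ 0 := by rintro rfl; simp at hMn; exact hn0 hMn.symm
  obtain ⟨i, j, N, g, hg, -, rfl⟩ := E.normal hM hM0
  have hg0 : g ≠ 0 := by rintro rfl; simp at hM0
  rw [E.natDegree_mon hf hr i j hg0] at hMn
  by_cases h : (E.ev g).natDegree = 0
  · rw [h, add_zero] at hMn
    obtain ⟨l, -, hl⟩ := Finset.exists_ne_zero_of_sum_ne_zero (hMn ▸ hn0)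
    have hle : i l * (E.xs l).natDegree ≤ n := hMn ▸ Finset.single_le_sum
      (f := fun l => i l * (E.xs l).natDegree) (fun _ _ => Nat.zero_le _) (Finset.mem_univ l)
    have hle' : (E.xs l).natDegree ≤ n :=
      (Nat.le_mul_of_pos_left _ (Nat.pos_of_ne_zero (left_ne_zero_of_mul hl))).trans hle
    exact ⟨_, _, E.xs_mem l, right_ne_zero_of_mul hl,
      fun γ d hd h => hle'.trans (hmin γ d hd h), .inl ⟨l, rfl, rfl⟩⟩
  · exact ⟨_, _, E.ev_mem hg, h, fun γ d hd h => le_trans (by omega) (hmin γ d hd h),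
      .inr ⟨N, g, hg, rfl, rfl⟩⟩

end Domain
end GradedExp

namespace GradedExp
variable {k P : Type} [Field k] [CommRing P] [Algebra k P] {m : ℕ}
  {r : Fin m → ℕ} {a b wf : ℕ} {θ : Fin m → ℝ} {f : MvPolynomial (Fin 2) k}
  (E : GradedExp k P r a b wf θ f)

theorem choose_eq_zero [IsDomain P] {n : ℕ}
    (hmin : ∀ γ, ∀ d ∈ E.piece γ, d.natDegree ≠ 0 → n ≤ d.natDegree)
    {γ d} (hd : d ∈ E.piece γ) (hd0 : d ≠ 0) (l : ℕ) (hl : 0 < l) (hln : l < n) :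
    (d.natDegree.choose l : P) = 0 := by
  by_contra hne
  have hle : l ≤ d.natDegree := by
    by_contra h
    exact hne (by rw [Nat.choose_eq_zero_of_lt (not_le.mp h), Nat.cast_zero])
  obtain ⟨M, hM, hc⟩ := E.hasse hd (d.natDegree - l)
  have hdeg : M.natDegree = l := by
    apply le_antisymm
    · rw [Polynomial.natDegree_le_iff_coeff_eq_zero]
      intro N hN
      rw [hc, Polynomial.coeff_eq_zero_of_natDegree_lt (by omega), mul_zero]
    · apply Polynomial.le_natDegree_of_ne_zero
      rw [hc, Nat.sub_add_cancel hle]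
      exact mul_ne_zero hne (Polynomial.leadingCoeff_ne_zero.mpr hd0)
  have := hmin _ M hM (by omega)
  omega

theorem dvd_natDegree [IsDomain P] {σ s} (hs : s ∈ E.piece σ) (hs0 : s.natDegree ≠ 0)
    (hmin : ∀ γ, ∀ d ∈ E.piece γ, d.natDegree ≠ 0 → s.natDegree ≤ d.natDegree)
    {γ d} (hd : d ∈ E.piece γ) : s.natDegree ∣ d.natDegree := by
  by_cases hd0 : d = 0
  · simp [hd0]
  exact dvd_of_choose_eq_zero (P := P) (Nat.pos_of_ne_zero hs0)
    (E.choose_eq_zero hmin hs fun h => hs0 (by simp [h])) (E.choose_eq_zero hmin hd hd0)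

/-- Pseudo-division by an element of least positive degree. -/
theorem exists_pow_mul_eq [IsDomain P] {σ s} (hs : s ∈ E.piece σ) (hs0 : s.natDegree ≠ 0)
    (hmin : ∀ γ, ∀ d ∈ E.piece γ, d.natDegree ≠ 0 → s.natDegree ≤ d.natDegree)
    {c : Polynomial P} (hc : c = Polynomial.C s.leadingCoeff) {δ : ℝ}
    (hδ : δ = σ + s.natDegree * E.shift) {γ d} (hd : d ∈ E.piece γ) :
    ∃ N : ℕ, ∃ c₀ ∈ E.piece (γ + N * δ), ∃ q ∈ E.piece (γ + N * δ - σ),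
      c₀.natDegree = 0 ∧ c ^ N * d = c₀ + s * q := by
  have hcδ : c ∈ E.piece δ := by rw [hc, hδ]; exact E.C_leadingCoeff_mem hs
  induction hD : d.natDegree using Nat.strong_induction_on generalizing γ d with
  | _ D ih =>
  subst hD
  by_cases h0 : d.natDegree = 0
  · exact ⟨0, d, by simpa using hd, 0, zero_mem _, h0, by simp⟩
  obtain ⟨t, ht⟩ := E.dvd_natDegree hs hs0 hmin hd
  have ht0 : t ≠ 0 := by rintro rfl; simp at ht; exact h0 ht
  obtain ⟨t', rfl⟩ := Nat.exists_eq_succ_of_ne_zero ht0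
  have hsne : s ≠ 0 := by rintro rfl; simp at hs0
  have hdne : d ≠ 0 := by rintro rfl; simp at h0
  have hp : Polynomial.C d.leadingCoeff ∈ E.piece (γ + (t' + 1) * (δ - σ)) := by
    convert E.C_leadingCoeff_mem hd using 2
    rw [ht, hδ]; push_cast; ring
  have hcne : c ≠ 0 := by
    rw [hc]; exact Polynomial.C_ne_zero.mpr (Polynomial.leadingCoeff_ne_zero.mpr hsne)
  have hdeg : (c ^ (t' + 1) * d - Polynomial.C d.leadingCoeff * s ^ (t' + 1)).natDegree
      < d.natDegree := by
    have e1 : (c ^ (t' + 1) * d).natDegree = d.natDegree := by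
      rw [Polynomial.natDegree_mul (pow_ne_zero _ hcne) hdne, Polynomial.natDegree_pow, hc]
      simp
    have e2 : (Polynomial.C d.leadingCoeff * s ^ (t' + 1)).natDegree = d.natDegree := by
      rw [Polynomial.natDegree_C_mul (Polynomial.leadingCoeff_ne_zero.mpr hdne),
        Polynomial.natDegree_pow, ht, mul_comm]
    have hne := mul_ne_zero (pow_ne_zero (t' + 1) hcne) hdne
    have hne' : Polynomial.C d.leadingCoeff * s ^ (t' + 1) ≠ 0 :=
      mul_ne_zero (by simpa using hdne) (pow_ne_zero _ hsne)
    have hlt := Polynomial.degree_sub_lt_left (p := c ^ (t' + 1) * d)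
      (q := Polynomial.C d.leadingCoeff * s ^ (t' + 1)) (by
      rw [Polynomial.degree_eq_natDegree hne, Polynomial.degree_eq_natDegree hne', e1, e2]) hne (by
      rw [Polynomial.leadingCoeff_mul, Polynomial.leadingCoeff_mul, Polynomial.leadingCoeff_pow,
        Polynomial.leadingCoeff_pow, hc]
      simp [mul_comm])
    by_cases hz : c ^ (t' + 1) * d - Polynomial.C d.leadingCoeff * s ^ (t' + 1) = 0
    · rw [hz, Polynomial.natDegree_zero]
      exact Nat.pos_of_ne_zero h0
    · exact (Polynomial.natDegree_lt_natDegree hz hlt).trans_eq e1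
  have hmem : c ^ (t' + 1) * d - Polynomial.C d.leadingCoeff * s ^ (t' + 1)
      ∈ E.piece (γ + (t' + 1) * δ) := by
    refine sub_mem ?_ ?_
    · convert E.mul_mem (E.pow_mem hcδ (t' + 1)) hd using 2
      push_cast; ring
    · convert E.mul_mem hp (E.pow_mem hs (t' + 1)) using 2
      push_cast; ring
  obtain ⟨N, c₀, hc₀, q, hq, hdeg₀, heq⟩ := ih _ hdeg hmem rfl
  refine ⟨N + (t' + 1), c₀, ?_, q + c ^ N * (Polynomial.C d.leadingCoeff * s ^ t'), ?_, hdeg₀, ?_⟩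
  · convert hc₀ using 2
    push_cast; ring
  · refine add_mem ?_ ?_
    · convert hq using 2
      push_cast; ring
    · convert E.mul_mem (E.pow_mem hcδ N) (E.mul_mem hp (E.pow_mem hs t')) using 2
      push_cast; ring
  · rw [pow_add c, mul_assoc]
    linear_combination heq
end GradedExp

namespace GradedExp
variable {k P : Type} [Field k] [CommRing P] [Algebra k P] {m : ℕ}
  {r : Fin m → ℕ} {a b wf : ℕ} {θ : Fin m → ℝ} {f : MvPolynomial (Fin 2) k}
  (E : GradedExp k P r a b wf θ f)

/-- The monomial `xs ^ i * y ^ j * ev g`. -/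
def mon (i : Fin m → ℕ) (j : ℕ) (g : MvPolynomial (Fin 2) k) : Polynomial P :=
  (∏ l, E.xs l ^ i l) * E.y ^ j * E.ev g

theorem mon_mul (i i' : Fin m → ℕ) (j j' : ℕ) (g g' : MvPolynomial (Fin 2) k) :
    E.mon i j g * E.mon i' j' g' = E.mon (i + i') (j + j') (g * g') := by
  simp only [mon, Pi.add_apply, pow_add, Finset.prod_mul_distrib, map_mul]
  ring

theorem mon_pow (n : ℕ) (i : Fin m → ℕ) (j : ℕ) (g : MvPolynomial (Fin 2) k) :
    E.mon i j g ^ n = E.mon (n • i) (n * j) (g ^ n) := by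
  simp only [mon, Pi.smul_apply, smul_eq_mul, mul_pow, map_pow, ← Finset.prod_pow, ← pow_mul,
    mul_comm n]

theorem mon_single (l : Fin m) : E.mon (Pi.single l 1) 0 1 = E.xs l := by
  classical
  simp only [mon, pow_zero, mul_one, map_one]
  rw [Finset.prod_eq_single l (fun l' _ h => by simp [h]) (by simp)]
  simp

theorem mon_zero (g : MvPolynomial (Fin 2) k) : E.mon 0 0 g = E.ev g := by
  simp [mon]

/-- The homogeneous polynomials whose image under `ev` is constant. -/
def Konst (g : MvPolynomial (Fin 2) k) (N : ℕ) : Prop :=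
  IsWeightedHomogeneous ![a, b] g N ∧ g ≠ 0 ∧ (E.ev g).natDegree = 0

variable {E} in
theorem Konst.mul [IsDomain P] {g g' N N'} (h : E.Konst g N) (h' : E.Konst g' N') :
    E.Konst (g * g') (N + N') :=
  ⟨h.1.mul h'.1, mul_ne_zero h.2.1 h'.2.1, by
    rw [map_mul, Polynomial.natDegree_mul (E.ev_ne_zero h.2.1) (E.ev_ne_zero h'.2.1), h.2.2,
      h'.2.2]⟩

variable {E} in
theorem Konst.pow [IsDomain P] {g N} (h : E.Konst g N) (n : ℕ) : E.Konst (g ^ n) (n * N) :=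
  ⟨by simpa using h.1.pow n, pow_ne_zero _ h.2.1, by
    rw [map_pow, Polynomial.natDegree_pow, h.2.2, mul_zero]⟩

theorem exists_eq_mon {γ M} (hM : M ∈ E.piece γ) (hM0 : M ≠ 0) : ∃ i j N g,
    IsWeightedHomogeneous ![a, b] g N ∧ g ≠ 0 ∧ γ = monWeight r wf θ i j N ∧ M = E.mon i j g := by
  obtain ⟨i, j, N, g, h₁, h₂, h₃⟩ := E.normal hM hM0
  refine ⟨i, j, N, g, h₁, ?_, h₂, h₃⟩
  rintro rfl
  simp [h₃] at hM0

theorem natDegree_mon_eq_zero [IsDomain P] (hf : f ≠ 0) (hr : ∀ l, 1 < r l) {i : Fin m → ℕ}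
    {j : ℕ} {g} (hg : g ≠ 0) (h : (E.mon i j g).natDegree = 0) :
    (∀ l, (E.xs l).natDegree ≠ 0 → i l = 0) ∧ (E.ev g).natDegree = 0 := by
  rw [mon, E.natDegree_mon hf hr i j hg, Nat.add_eq_zero_iff, Finset.sum_eq_zero_iff] at h
  exact ⟨fun l hl => (Nat.mul_eq_zero.mp (h.1 l (Finset.mem_univ l))).resolve_right hl, h.2⟩

/-- An element of least positive degree together with its leading coefficient. -/
structure Min where
  is : Fin m → ℕ
  gs : MvPolynomial (Fin 2) k
  Gs : ℕ
  hgs : IsWeightedHomogeneous ![a, b] gs Gs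
  cases : (∃ l, is = Pi.single l 1 ∧ gs = 1) ∨ is = 0
  mem : E.mon is 0 gs ∈ E.piece (monWeight r wf θ is 0 Gs)
  ne : (E.mon is 0 gs).natDegree ≠ 0
  min : ∀ γ, ∀ d ∈ E.piece γ, d.natDegree ≠ 0 → (E.mon is 0 gs).natDegree ≤ d.natDegree
  i : Fin m → ℕ
  j : ℕ
  g : MvPolynomial (Fin 2) k
  G : ℕ
  hg : E.Konst g G
  hi : ∀ l, (E.xs l).natDegree ≠ 0 → i l = 0
  hc : E.mon i j g = Polynomial.C (E.mon is 0 gs).leadingCoeff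
  hδ : monWeight r wf θ i j G
    = monWeight r wf θ is 0 Gs + (E.mon is 0 gs).natDegree * E.shift

theorem nonempty_min [IsDomain P] (hf : f ≠ 0) (hr : ∀ l, 1 < r l) : Nonempty E.Min := by
  obtain ⟨is, gs, Gs, hgs, hcases, hs, hs0, hmin⟩ : ∃ (is : Fin m → ℕ) (gs : _) (Gs : ℕ),
      IsWeightedHomogeneous ![a, b] gs Gs ∧ ((∃ l, is = Pi.single l 1 ∧ gs = 1) ∨ is = 0) ∧
      E.mon is 0 gs ∈ E.piece (monWeight r wf θ is 0 Gs) ∧ (E.mon is 0 gs).natDegree ≠ 0 ∧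
      ∀ γ, ∀ d ∈ E.piece γ, d.natDegree ≠ 0 → (E.mon is 0 gs).natDegree ≤ d.natDegree := by
    obtain ⟨σ, s, hs, hs0, hmin, ⟨l, rfl, rfl⟩ | ⟨N, g, hg, rfl, rfl⟩⟩ := E.exists_min hf hr
    · refine ⟨Pi.single l 1, 1, 0, isWeightedHomogeneous_one _ _, .inl ⟨l, rfl, rfl⟩, ?_⟩
      rw [mon_single, monWeight_single]
      exact ⟨hs, hs0, hmin⟩
    · refine ⟨0, g, N, hg, .inr rfl, ?_⟩
      rw [mon_zero, monWeight_zero]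
      exact ⟨hs, hs0, hmin⟩
  have hcne : Polynomial.C (E.mon is 0 gs).leadingCoeff ≠ 0 := by
    rw [Ne, Polynomial.C_eq_zero, Polynomial.leadingCoeff_eq_zero]
    intro h; simp [h] at hs0
  obtain ⟨i, j, G, g, hg, hg0, hδ, hc⟩ := E.exists_eq_mon (E.C_leadingCoeff_mem hs) hcne
  have := E.natDegree_mon_eq_zero hf hr hg0 (i := i) (j := j) (by rw [← hc]; simp)
  exact ⟨⟨is, gs, Gs, hgs, hcases, hs, hs0, hmin, i, j, g, G, ⟨hg, hg0, this.2⟩, this.1, hc.symm,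
    hδ.symm⟩⟩

variable {E}

theorem Min.reduce [IsDomain P] (S : E.Min) (hf : f ≠ 0) (hr : ∀ l, 1 < r l)
    (hθ : ∀ (c : Fin m → ℤ) (e : ℤ), ∑ l, (c l : ℝ) * θ l = e → c = 0)
    {i₁ : Fin m → ℕ} {N₁ : ℕ} {g₁} (hg₁ : g₁ ≠ 0)
    (hd : E.mon i₁ 0 g₁ ∈ E.piece (monWeight r wf θ i₁ 0 N₁)) : ∃ N : ℕ,
    (∃ (i₀ : Fin m → ℕ) (j₀ G₀ : ℕ) (g₀ : _), E.Konst g₀ G₀ ∧ (∀ l, (E.xs l).natDegree ≠ 0 → i₀ l = 0) ∧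
      (∀ l, i₀ l + N * S.j * r l = N * S.i l + i₁ l + j₀ * r l) ∧
      G₀ + j₀ * wf = N * S.G + N₁ + N * S.j * wf) ∨
    (∃ (i' : Fin m → ℕ) (j' : ℕ) (g' : _), E.mon S.i S.j S.g ^ N * E.mon i₁ 0 g₁ = E.mon S.is 0 S.gs * E.mon i' j' g' ∧
      ∀ l, N * S.i l + i₁ l + j' * r l = S.is l + i' l + N * S.j * r l) := by
  obtain ⟨N, c₀, hc₀, q, hq, hdeg, heq⟩ :=
    E.exists_pow_mul_eq S.mem S.ne S.min S.hc S.hδ hd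
  have hw : monWeight r wf θ i₁ 0 N₁ + N * monWeight r wf θ S.i S.j S.G
      = monWeight r wf θ (i₁ + N • S.i) (0 + N * S.j) (N₁ + N * S.G) := by
    rw [monWeight_add, monWeight_nsmul]
  refine ⟨N, ?_⟩
  by_cases h0 : c₀ = 0
  · right
    have hcne : E.mon S.i S.j S.g ≠ 0 := by
      rw [S.hc, Ne, Polynomial.C_eq_zero, Polynomial.leadingCoeff_eq_zero]
      intro h; exact S.ne (by simp [h])
    have hdne : E.mon i₁ 0 g₁ ≠ 0 := by
      refine mul_ne_zero (mul_ne_zero (Finset.prod_ne_zero_iff.mpr fun l _ => ?_) ?_)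
        (E.ev_ne_zero hg₁)
      · exact pow_ne_zero _ (E.xs_ne_zero hf hr l)
      · simp
    have hqne : q ≠ 0 := by
      rintro rfl
      rw [h0, mul_zero, add_zero] at heq
      exact mul_ne_zero (pow_ne_zero _ hcne) hdne heq
    obtain ⟨i', j', G', g', hg', hg0', hw', rfl⟩ := E.exists_eq_mon hq hqne
    refine ⟨i', j', g', by rw [heq, h0, zero_add], fun l => ?_⟩
    rw [hw, sub_eq_iff_eq_add, ← monWeight_add] at hw'
    have := (eq_of_monWeight_eq hθ hw').1 l
    simp only [Pi.add_apply, Pi.smul_apply, smul_eq_mul, zero_add, add_zero] at this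
    linarith
  · left
    obtain ⟨i₀, j₀, G₀, g₀, hg₀, hg0, hw₀, rfl⟩ := E.exists_eq_mon hc₀ h0
    have hk := E.natDegree_mon_eq_zero hf hr hg0 hdeg
    rw [hw] at hw₀
    obtain ⟨h₁, h₂⟩ := eq_of_monWeight_eq hθ hw₀
    refine ⟨i₀, j₀, G₀, g₀, ⟨hg₀, hg0, hk.2⟩, hk.1, fun l => ?_, ?_⟩
    · have := h₁ l
      simp only [Pi.add_apply, Pi.smul_apply, smul_eq_mul, zero_add] at this
      linarith
    · simp only [zero_add] at h₂
      linarith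
end GradedExp

namespace GradedExp
variable {k P : Type} [Field k] [CommRing P] [Algebra k P] {m : ℕ}
  {r : Fin m → ℕ} {a b wf : ℕ} {θ : Fin m → ℝ} {f : MvPolynomial (Fin 2) k}
  (E : GradedExp k P r a b wf θ f)

theorem natDegree_ev_C (c : k) : (E.ev (C c)).natDegree = 0 := by
  rw [← algebraMap_eq, AlgHom.commutes, Polynomial.algebraMap_apply, Polynomial.natDegree_C]

theorem natDegree_ev_eq_zero (h₀ : (E.ev (X 0)).natDegree = 0) (h₁ : (E.ev (X 1)).natDegree = 0)
    (g : MvPolynomial (Fin 2) k) : (E.ev g).natDegree = 0 := by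
  induction g using MvPolynomial.induction_on with
  | C c => exact E.natDegree_ev_C c
  | add p q hp hq =>
    rw [map_add]
    exact Nat.le_zero.mp ((Polynomial.natDegree_add_le _ _).trans (by simp [hp, hq]))
  | mul_X p i hp =>
    rw [map_mul]
    refine Nat.le_zero.mp (Polynomial.natDegree_mul_le.trans ?_)
    fin_cases i
    · simp [hp, h₀]
    · simp [hp, h₁]

variable [IsDomain P]

theorem natDegree_xs_eq_zero (hf : f ≠ 0) (hr : ∀ l, 1 < r l) (h : (E.ev f).natDegree = 0)
    (l : Fin m) : (E.xs l).natDegree = 0 := by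
  rw [← E.rel] at h
  have h' : (E.mon r 1 1).natDegree = 0 := by simpa [mon] using h
  by_contra hl
  have := (E.natDegree_mon_eq_zero hf hr one_ne_zero h').1 l hl
  have := hr l
  omega

theorem exists_natDegree_ev_X_ne_zero (hf : f ≠ 0) (hr : ∀ l, 1 < r l) :
    (E.ev (X 0)).natDegree ≠ 0 ∨ (E.ev (X 1)).natDegree ≠ 0 := by
  by_contra! h
  have hev := E.natDegree_ev_eq_zero h.1 h.2
  obtain ⟨γ, M, hM, hM0⟩ := E.nontriv
  obtain ⟨i, j, N, g, -, hg0, -, rfl⟩ := E.exists_eq_mon hM (by rintro rfl; simp at hM0)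
  apply hM0
  rw [mon, E.natDegree_mon hf hr i j hg0, hev]
  simp [E.natDegree_xs_eq_zero hf hr (hev f)]

theorem exists_natDegree_ev_X_eq (hf : f ≠ 0) (hr : ∀ l, 1 < r l) (ha : 0 < a)
    (hab : a.Coprime b) {c : k} (hc : c ≠ 0)
    (he : (E.ev (X 0 ^ b - C c * X 1 ^ a)).natDegree = 0) :
    ∃ δ, 0 < δ ∧ (E.ev (X 0)).natDegree = a * δ ∧ (E.ev (X 1)).natDegree = b * δ := by
  have e1 : (E.ev (X 0 ^ b)).natDegree = b * (E.ev (X 0)).natDegree := by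
    rw [map_pow, Polynomial.natDegree_pow]
  have e2 : (E.ev (C c * X 1 ^ a)).natDegree = a * (E.ev (X 1)).natDegree := by
    rw [map_mul, Polynomial.natDegree_mul (E.ev_ne_zero (C_ne_zero.mpr hc))
      (E.ev_ne_zero (pow_ne_zero _ (X_ne_zero _))), E.natDegree_ev_C, map_pow,
      Polynomial.natDegree_pow, zero_add]
  have h : b * (E.ev (X 0)).natDegree = a * (E.ev (X 1)).natDegree := by
    rw [← e1, ← e2]
    rw [map_sub] at he
    rcases lt_trichotomy (E.ev (X 0 ^ b)).natDegree (E.ev (C c * X 1 ^ a)).natDegree with h | h | h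
    · rw [Polynomial.natDegree_sub_eq_right_of_natDegree_lt h] at he
      omega
    · exact h
    · rw [Polynomial.natDegree_sub_eq_left_of_natDegree_lt h] at he
      omega
  obtain ⟨δ, hδ⟩ := hab.dvd_of_dvd_mul_left (Dvd.intro _ h.symm)
  have h1 : (E.ev (X 1)).natDegree = b * δ := by
    apply Nat.eq_of_mul_eq_mul_left ha
    rw [← h, hδ]; ring
  refine ⟨δ, Nat.pos_of_ne_zero ?_, hδ, h1⟩
  rintro rfl
  rcases E.exists_natDegree_ev_X_ne_zero hf hr with h | h
  · exact h hδ
  · exact h h1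

theorem natDegree_ev_monomial {δ : ℕ} (h₀ : (E.ev (X 0)).natDegree = a * δ)
    (h₁ : (E.ev (X 1)).natDegree = b * δ) {c : k} (hc : c ≠ 0) (i j : ℕ) :
    (E.ev (C c * (X 0 ^ i * X 1 ^ j))).natDegree = (i * a + j * b) * δ := by
  have hX : ∀ n, E.ev (X n) ≠ 0 := fun n => E.ev_ne_zero (X_ne_zero n)
  simp only [map_mul, map_pow]
  rw [Polynomial.natDegree_mul (E.ev_ne_zero (C_ne_zero.mpr hc))
    (mul_ne_zero (pow_ne_zero _ (hX 0)) (pow_ne_zero _ (hX 1))), E.natDegree_ev_C,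
    Polynomial.natDegree_mul (pow_ne_zero _ (hX 0)) (pow_ne_zero _ (hX 1)),
    Polynomial.natDegree_pow, Polynomial.natDegree_pow, h₀, h₁]
  ring

theorem natDegree_ev_le {δ : ℕ} (h₀ : (E.ev (X 0)).natDegree = a * δ)
    (h₁ : (E.ev (X 1)).natDegree = b * δ) {h : MvPolynomial (Fin 2) k} {N : ℕ}
    (hh : IsWeightedHomogeneous ![a, b] h N) : (E.ev h).natDegree ≤ N * δ := by
  rw [h.as_sum, map_sum]
  refine Polynomial.natDegree_sum_le_of_forall_le _ _ fun d hd => ?_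
  have hd' := mem_support_iff.mp hd
  have : monomial d (coeff d h) = C (coeff d h) * (X 0 ^ d 0 * X 1 ^ d 1) := by
    rw [monomial_eq, Finsupp.prod_fintype _ _ (fun _ => pow_zero _), Fin.prod_univ_two]
  rw [this, E.natDegree_ev_monomial h₀ h₁ hd', ← weight_pair, hh hd']

theorem dvd_of_konst (hf : f ≠ 0) (hr : ∀ l, 1 < r l) (ha : 0 < a) (hb : 0 < b)
    (hab : a.Coprime b) {c : k} (hc : c ≠ 0)
    (he : (E.ev (X 0 ^ b - C c * X 1 ^ a)).natDegree = 0) {N : ℕ} :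
    ∀ {g}, E.Konst g N → a * b ∣ N := by
  obtain ⟨δ, hδ, h₀, h₁⟩ := E.exists_natDegree_ev_X_eq hf hr ha hab hc he
  induction N using Nat.strong_induction_on with
  | _ N ih =>
  rintro g ⟨hg, hg0, hgk⟩
  obtain ⟨h, κ, i, j, heq, hκ, hh⟩ := exists_eq_binomial_mul_add c hb hab hg
  rcases Nat.eq_zero_or_pos N with rfl | hN
  · simp
  have hab0 : 0 < a * b := Nat.mul_pos ha hb
  have hhom : IsWeightedHomogeneous ![a, b] h (N - a * b) := fun d hd => by
    have := hh d hd; omega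
  have hle : h ≠ 0 → a * b ≤ N := fun h0 => by
    obtain ⟨d, hd⟩ := support_nonempty.mpr h0
    have := hh d (mem_support_iff.mp hd)
    omega
  have hκ0 : κ = 0 := by
    by_contra hκ0
    have hm := E.natDegree_ev_monomial h₀ h₁ hκ0 i j
    rw [hκ hκ0] at hm
    have hlt : (E.ev ((X 0 ^ b - C c * X 1 ^ a) * h)).natDegree < N * δ := by
      by_cases h0 : h = 0
      · rw [h0, mul_zero, map_zero, Polynomial.natDegree_zero]
        exact Nat.mul_pos hN hδ
      · rw [map_mul]
        refine Polynomial.natDegree_mul_le.trans_lt ?_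
        rw [he, zero_add]
        refine (E.natDegree_ev_le h₀ h₁ hhom).trans_lt ?_
        have := hle h0
        exact Nat.mul_lt_mul_of_pos_right (by omega) hδ
    rw [heq, map_add, Polynomial.natDegree_add_eq_right_of_natDegree_lt (by rwa [hm]), hm] at hgk
    exact (Nat.mul_pos hN hδ).ne' hgk
  rw [hκ0, C_0, zero_mul, add_zero] at heq
  have hh0 : h ≠ 0 := by rintro rfl; exact hg0 (by rw [heq, mul_zero])
  have := hle hh0
  have hk : E.Konst h (N - a * b) := by
    refine ⟨hhom, hh0, natDegree_eq_zero_of_dvd_of_natDegree_eq_zero ?_ (E.ev_ne_zero hg0) hgk⟩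
    rw [heq, map_mul]
    exact dvd_mul_left _ _
  have hdvd := ih (N - a * b) (by omega) hk
  rw [show N = N - a * b + a * b by omega]
  exact dvd_add hdvd dvd_rfl

variable {E}

/-- No constant homogeneous polynomial vanishes at a point off the axes. -/
theorem Konst.aeval_ne_zero (hf : f ≠ 0) (hr : ∀ l, 1 < r l) (ha : 2 ≤ a) (hb : 2 ≤ b)
    (hab : a.Coprime b) (hfw : IsWeightedHomogeneous ![a, b] f wf)
    (hθ : ∀ (c : Fin m → ℤ) (e : ℤ), ∑ l, (c l : ℝ) * θ l = e → c = 0)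
    {α β : k} (hα : α ≠ 0) (hβ : β ≠ 0) {g N} (hg : E.Konst g N) : aeval ![α, β] g ≠ 0 := by
  intro hz
  obtain ⟨S⟩ := E.nonempty_min hf hr
  set c : k := α ^ b / β ^ a with hcdef
  have hc : c ≠ 0 := div_ne_zero (pow_ne_zero _ hα) (pow_ne_zero _ hβ)
  have he : (E.ev (X 0 ^ b - C c * X 1 ^ a)).natDegree = 0 ∧
      (X 0 ^ b - C c * X 1 ^ a : MvPolynomial (Fin 2) k) ≠ 0 := by
    obtain ⟨h, κ, i, j, heq, -, -⟩ := exists_eq_binomial_mul_add c (by omega) hab hg.1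
    have hκ : κ = 0 := by
      rw [heq] at hz
      simp only [map_add, map_mul, map_sub, map_pow, aeval_X, aeval_C, Algebra.algebraMap_self,
        RingHom.id_apply, Matrix.cons_val_zero, Matrix.cons_val_one] at hz
      rw [hcdef, div_mul_cancel₀ _ (pow_ne_zero _ hβ), sub_self, zero_mul, zero_add] at hz
      exact (mul_eq_zero.mp hz).resolve_right
        (mul_ne_zero (pow_ne_zero _ hα) (pow_ne_zero _ hβ))
    rw [hκ, C_0, zero_mul, add_zero] at heq
    refine ⟨natDegree_eq_zero_of_dvd_of_natDegree_eq_zero ?_ (E.ev_ne_zero hg.2.1) hg.2.2, ?_⟩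
    · rw [heq, map_mul]
      exact dvd_mul_right _ _
    · intro h0
      exact hg.2.1 (by rw [heq, h0, zero_mul])
  have hdvd : ∀ {N g}, E.Konst g N → a * b ∣ N :=
    fun h => E.dvd_of_konst hf hr (by omega) (by omega) hab hc he.1 h
  have key : ∀ n : Fin 2, ∃ N : ℕ, E.mon S.is 0 S.gs ∣ E.mon S.i S.j S.g ^ N * E.ev (X n) := by
    intro n
    have hX : IsWeightedHomogeneous ![a, b] (X n : MvPolynomial (Fin 2) k) (![a, b] n) :=
      isWeightedHomogeneous_X _ _ _
    have hmem : E.mon 0 0 (X n) ∈ E.piece (monWeight r wf θ 0 0 (![a, b] n)) := by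
      rw [mon_zero, monWeight_zero]
      exact E.ev_mem hX
    obtain ⟨N, ⟨i₀, j₀, G₀, g₀, hg₀, hi₀, hij, hG⟩ | ⟨i', j', g', heq, -⟩⟩ :=
      S.reduce hf hr hθ (X_ne_zero n) hmem
    · exfalso
      have h1 := hdvd hg₀
      have h2 := hdvd S.hg
      have h3 : a * b ∣ ![a, b] n := by
        by_cases hx : ∀ l, (E.xs l).natDegree = 0
        · have hfk : E.Konst f wf := by
            refine ⟨hfw, hf, ?_⟩
            rw [← E.rel]
            refine Nat.le_zero.mp (Polynomial.natDegree_mul_le.trans ?_)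
            rw [E.natDegree_y, add_zero, Polynomial.natDegree_prod _ _ fun l _ =>
              pow_ne_zero _ (E.xs_ne_zero hf hr l)]
            simp [Polynomial.natDegree_pow, hx]
          have h4 := hdvd hfk
          have h5 : a * b ∣ N * S.G + ![a, b] n + N * S.j * wf :=
            hG ▸ dvd_add h1 (h4.mul_left _)
          exact (Nat.dvd_add_right (h2.mul_left _)).mp ((Nat.dvd_add_left (h4.mul_left _)).mp h5)
        · push Not at hx
          obtain ⟨l, hl⟩ := hx
          have hl' := hij l
          rw [hi₀ l hl, S.hi l hl, mul_zero, Pi.zero_apply, zero_add, zero_add, zero_add] at hl'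
          have hj := Nat.eq_of_mul_eq_mul_right (by have := hr l; omega) hl'
          rw [hj] at hG
          have h5 : a * b ∣ N * S.G + ![a, b] n := by
            rw [← Nat.add_right_cancel hG]; exact h1
          exact (Nat.dvd_add_right (h2.mul_left _)).mp h5
      have hpos : 0 < ![a, b] n ∧ ![a, b] n < a * b := by
        fin_cases n
        · simp; constructor <;> nlinarith
        · simp; constructor <;> nlinarith
      exact absurd (Nat.le_of_dvd hpos.1 h3) (not_le.mpr hpos.2)
    · refine ⟨N, ?_⟩
      rw [mon_zero] at heq
      rw [heq]
      exact dvd_mul_right _ _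
  obtain ⟨N₀, h₀⟩ := key 0
  obtain ⟨N₁, h₁⟩ := key 1
  set s := E.mon S.is 0 S.gs
  set cM := E.mon S.i S.j S.g with hcM
  have h0' : s ∣ cM ^ (N₀ * b + N₁ * a) * E.ev (X 0) ^ b := by
    have : s ∣ (cM ^ N₀ * E.ev (X 0)) ^ b := h₀.trans (dvd_pow_self _ (by omega))
    rw [mul_pow, ← pow_mul] at this
    rw [pow_add, mul_comm (cM ^ (N₀ * b)), mul_assoc]
    exact this.mul_left _
  have h1' : s ∣ cM ^ (N₀ * b + N₁ * a) * E.ev (X 1) ^ a := by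
    have : s ∣ (cM ^ N₁ * E.ev (X 1)) ^ a := h₁.trans (dvd_pow_self _ (by omega))
    rw [mul_pow, ← pow_mul] at this
    rw [pow_add, mul_assoc]
    exact this.mul_left _
  have hs : s ∣ cM ^ (N₀ * b + N₁ * a) * E.ev (X 0 ^ b - C c * X 1 ^ a) := by
    have := dvd_sub h0' (h1'.mul_left (E.ev (C c)))
    convert this using 1
    simp only [map_sub, map_mul, map_pow]
    ring
  have hcM0 : cM ≠ 0 := by
    rw [hcM, S.hc, Ne, Polynomial.C_eq_zero, Polynomial.leadingCoeff_eq_zero]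
    intro h; exact S.ne (by simp [h])
  refine S.ne (natDegree_eq_zero_of_dvd_of_natDegree_eq_zero hs
    (mul_ne_zero (pow_ne_zero _ hcM0) (E.ev_ne_zero he.2)) ?_)
  rw [Polynomial.natDegree_mul (pow_ne_zero _ hcM0) (E.ev_ne_zero he.2), he.1,
    Polynomial.natDegree_pow, hcM, S.hc, Polynomial.natDegree_C, mul_zero]
end GradedExp

/-- Evaluating a weighted homogeneous polynomial at `(α u ^ a, β u ^ b)`. -/
theorem aeval_monomial_curve {k : Type} [Field k] {a b : ℕ} (α β : k)
    {g : MvPolynomial (Fin 2) k} {N : ℕ} (hg : IsWeightedHomogeneous ![a, b] g N) :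
    aeval ![Polynomial.monomial a α, Polynomial.monomial b β] g
      = Polynomial.monomial N (aeval ![α, β] g) := by
  rw [g.as_sum, map_sum, map_sum, map_sum]
  refine Finset.sum_congr rfl fun d hd => ?_
  rw [aeval_monomial, aeval_monomial, Finsupp.prod_fintype _ _ (fun _ => pow_zero _),
    Finsupp.prod_fintype _ _ (fun _ => pow_zero _), Fin.prod_univ_two, Fin.prod_univ_two]
  have := hg (mem_support_iff.mp hd)
  rw [weight_pair] at this
  simp only [Matrix.cons_val_zero, Matrix.cons_val_one, Polynomial.monomial_pow,
    Polynomial.monomial_mul_monomial, Polynomial.algebraMap_apply, Algebra.algebraMap_self,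
    RingHom.id_apply, Polynomial.C_mul_monomial]
  rw [← this, mul_comm a, mul_comm b]

theorem coeff_one_aeval_monomial_curve {k : Type} [Field k] {a b : ℕ} (ha : 2 ≤ a) (hb : 2 ≤ b)
    (α β : k) (g : MvPolynomial (Fin 2) k) :
    (aeval ![Polynomial.monomial a α, Polynomial.monomial b β] g).coeff 1 = 0 := by
  rw [g.as_sum, map_sum, Polynomial.finsetSum_coeff]
  refine Finset.sum_eq_zero fun d hd => ?_
  rw [aeval_monomial, Finsupp.prod_fintype _ _ (fun _ => pow_zero _), Fin.prod_univ_two]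
  simp only [Matrix.cons_val_zero, Matrix.cons_val_one, Polynomial.monomial_pow,
    Polynomial.monomial_mul_monomial, Polynomial.algebraMap_apply, Algebra.algebraMap_self,
    RingHom.id_apply, Polynomial.C_mul_monomial]
  rw [Polynomial.coeff_monomial, if_neg]
  intro h
  rcases Nat.eq_zero_or_pos (d 0) with h0 | h0 <;> rcases Nat.eq_zero_or_pos (d 1) with h1 | h1
  · simp [h0, h1] at h
  · nlinarith
  · nlinarith
  · nlinarith

namespace GradedExp
variable {k P : Type} [Field k] [CommRing P] [Algebra k P] [IsDomain P] {m : ℕ}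
  {r : Fin m → ℕ} {a b wf : ℕ} {θ : Fin m → ℝ} {f : MvPolynomial (Fin 2) k}
  {E : GradedExp k P r a b wf θ f}

theorem exists_natDegree_xs_ne_zero (E : GradedExp k P r a b wf θ f) (hf : f ≠ 0)
    (hr : ∀ l, 1 < r l) (h : (E.ev f).natDegree ≠ 0) : ∃ l, (E.xs l).natDegree ≠ 0 := by
  by_contra! hx
  apply h
  rw [← E.rel]
  refine Nat.le_zero.mp (Polynomial.natDegree_mul_le.trans ?_)
  rw [E.natDegree_y, add_zero, Polynomial.natDegree_prod _ _ fun l _ =>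
    pow_ne_zero _ (E.xs_ne_zero hf hr l)]
  simp [Polynomial.natDegree_pow, hx]

theorem Min.is_ne_zero (S : E.Min) (hf : f ≠ 0) (hr : ∀ l, 1 < r l)
    (hθ : ∀ (c : Fin m → ℤ) (e : ℤ), ∑ l, (c l : ℝ) * θ l = e → c = 0)
    (hev : (E.ev f).natDegree ≠ 0) : S.is ≠ 0 := by
  intro his
  obtain ⟨l, hl⟩ := E.exists_natDegree_xs_ne_zero hf hr hev
  have hrl := hr l
  have hmem : E.mon (Pi.single l 1) 0 1 ∈ E.piece (monWeight r wf θ (Pi.single l 1) 0 0) := by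
    rw [mon_single, monWeight_single]
    exact E.xs_mem l
  obtain ⟨N, ⟨i₀, j₀, G₀, g₀, -, hi₀, hij, -⟩ | ⟨i', j', g', heq, hij⟩⟩ :=
    S.reduce hf hr hθ one_ne_zero hmem
  · have h := hij l
    rw [hi₀ l hl, S.hi l hl, Pi.single_eq_same, mul_zero, zero_add, zero_add] at h
    have : r l ∣ 1 := (Nat.dvd_add_left (Dvd.intro_left _ rfl)).mp (h ▸ Dvd.intro_left _ rfl)
    have := Nat.le_of_dvd one_pos this
    omega
  · have h := hij l
    rw [S.hi l hl, Pi.single_eq_same, his, mul_zero, zero_add, Pi.zero_apply, zero_add] at h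
    have hj : N * S.j ≤ j' := by
      by_contra hlt
      have : (j' + 1) * r l ≤ N * S.j * r l := Nat.mul_le_mul_right _ (by omega)
      rw [add_mul] at this
      omega
    rw [mon_pow, mon_mul, mon_mul] at heq
    have := E.eq_of_mon_eq hf hr (fun l' => by
      have := hij l'
      simpa using this) (by simpa using hj) heq
    refine S.ne (natDegree_eq_zero_of_dvd_of_natDegree_eq_zero
      (q := E.ev (S.g ^ N)) ?_ (E.ev_ne_zero (S.hg.pow N).2.1) (S.hg.pow N).2.2)
    rw [mul_one] at this
    rw [this, his, mon_zero, map_mul, map_mul]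
    exact (dvd_mul_right _ _).mul_left _

theorem Min.exists_konst (S : E.Min) (hf : f ≠ 0) (hr : ∀ l, 1 < r l)
    (hθ : ∀ (c : Fin m → ℤ) (e : ℤ), ∑ l, (c l : ℝ) * θ l = e → c = 0)
    {α β : k} (hα : α ≠ 0) (hβ : β ≠ 0) (hz : aeval ![α, β] f = 0)
    (hg : aeval ![α, β] S.g ≠ 0) (hs : S.is ≠ 0) (n : Fin 2) :
    ∃ (N : ℕ) (g₀ : _), E.Konst g₀ (N * S.G + ![a, b] n) := by
  obtain ⟨l, his, hgs⟩ := S.cases.resolve_right hs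
  have hl : (E.xs l).natDegree ≠ 0 := by
    have := S.ne
    rwa [his, hgs, mon_single] at this
  have hrl := hr l
  have hmem : E.mon 0 0 (X n) ∈ E.piece (monWeight r wf θ 0 0 (![a, b] n)) := by
    rw [mon_zero, monWeight_zero]
    exact E.ev_mem (isWeightedHomogeneous_X _ _ _)
  obtain ⟨N, ⟨i₀, j₀, G₀, g₀, hg₀, hi₀, hij, hG⟩ | ⟨i', j', g', heq, hij⟩⟩ :=
    S.reduce hf hr hθ (X_ne_zero n) hmem
  · have h := hij l
    rw [hi₀ l hl, S.hi l hl, mul_zero, Pi.zero_apply, zero_add, zero_add, zero_add] at h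
    have hj := Nat.eq_of_mul_eq_mul_right (by omega) h
    rw [hj] at hG
    exact ⟨N, g₀, Nat.add_right_cancel hG ▸ hg₀⟩
  · exfalso
    have h := hij l
    rw [S.hi l hl, his, mul_zero, Pi.zero_apply, zero_add, zero_add, Pi.single_eq_same] at h
    have hj : N * S.j < j' := by
      by_contra hlt
      have : j' * r l ≤ N * S.j * r l := Nat.mul_le_mul_right _ (by omega)
      omega
    rw [mon_pow, mon_mul, mon_mul] at heq
    have := E.eq_of_mon_eq hf hr (fun l' => by
      have := hij l'
      simpa using this) (by simpa using hj.le) heq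
    have h2 := congrArg (aeval ![α, β]) this
    rw [add_zero, zero_add, map_mul, map_pow, map_mul, map_pow, hz,
      zero_pow (by omega), zero_mul, aeval_X] at h2
    refine mul_ne_zero (pow_ne_zero _ hg) ?_ h2
    fin_cases n
    · exact hα
    · exact hβ

/-- Constant homogeneous polynomials of the same weight are proportional. -/
theorem Konst.proportional (hf : f ≠ 0) (hr : ∀ l, 1 < r l) (ha : 2 ≤ a) (hb : 2 ≤ b)
    (hab : a.Coprime b) (hfw : IsWeightedHomogeneous ![a, b] f wf)
    (hθ : ∀ (c : Fin m → ℤ) (e : ℤ), ∑ l, (c l : ℝ) * θ l = e → c = 0)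
    {α β : k} (hα : α ≠ 0) (hβ : β ≠ 0) {g g' N} (hg : E.Konst g N) (hg' : E.Konst g' N) :
    C (aeval ![α, β] g) * g' = C (aeval ![α, β] g') * g := by
  rw [← sub_eq_zero]
  by_contra hne
  have hk : E.Konst (C (aeval ![α, β] g) * g' - C (aeval ![α, β] g') * g) N := by
    refine ⟨((weightedHomogeneousSubmodule k _ N).sub_mem (hg'.1.C_mul _) (hg.1.C_mul _)), hne, ?_⟩
    rw [map_sub, map_mul, map_mul]
    refine Nat.le_zero.mp ((Polynomial.natDegree_sub_le _ _).trans (max_le ?_ ?_))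
    · exact Polynomial.natDegree_mul_le.trans (by rw [E.natDegree_ev_C, hg'.2.2])
    · exact Polynomial.natDegree_mul_le.trans (by rw [E.natDegree_ev_C, hg.2.2])
  refine hk.aeval_ne_zero hf hr ha hb hab hfw hθ hα hβ ?_
  simp [mul_comm]

theorem not_exists (E : GradedExp k P r a b wf θ f) (hf : f ≠ 0) (hr : ∀ l, 1 < r l)
    (ha : 2 ≤ a) (hb : 2 ≤ b)
    (hab : a.Coprime b) (hfw : IsWeightedHomogeneous ![a, b] f wf)
    (hθ : ∀ (c : Fin m → ℤ) (e : ℤ), ∑ l, (c l : ℝ) * θ l = e → c = 0)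
    {α β : k} (hα : α ≠ 0) (hβ : β ≠ 0) (hz : aeval ![α, β] f = 0) : False := by
  obtain ⟨S⟩ := E.nonempty_min hf hr
  have hne : ∀ {g N}, E.Konst g N → aeval ![α, β] g ≠ 0 := fun h =>
    h.aeval_ne_zero hf hr ha hb hab hfw hθ hα hβ
  have hev : (E.ev f).natDegree ≠ 0 := fun h => hne ⟨hfw, hf, h⟩ hz
  have hs := S.is_ne_zero hf hr hθ hev
  obtain ⟨N₀, g₀, hg₀⟩ := S.exists_konst hf hr hθ hα hβ hz (hne S.hg) hs 0
  obtain ⟨N₁, g₁, hg₁⟩ := S.exists_konst hf hr hθ hα hβ hz (hne S.hg) hs 1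
  simp only [Matrix.cons_val_zero, Matrix.cons_val_one] at hg₀ hg₁
  obtain ⟨u, -, hu⟩ := Nat.exists_mul_mod_eq_one_of_coprime hab (by omega)
  obtain ⟨v, huv⟩ : ∃ v, u * a = v * b + 1 := by
    refine ⟨a * u / b, ?_⟩
    have := Nat.div_add_mod (a * u) b
    rw [hu] at this
    linarith [mul_comm a u, mul_comm b (a * u / b)]
  set W := v * (N₁ * S.G + b) + u * N₀ * S.G with hW
  have hA₁ : E.Konst (g₀ ^ u * S.g ^ (v * N₁)) (W + 1) := by
    have := (hg₀.pow u).mul (S.hg.pow (v * N₁))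
    convert this using 1
    rw [hW]
    linear_combination -huv
  have hA₂ : E.Konst (g₁ ^ v * S.g ^ (u * N₀)) W := (hg₁.pow v).mul (S.hg.pow (u * N₀))
  generalize g₀ ^ u * S.g ^ (v * N₁) = A₁ at hA₁
  generalize g₁ ^ v * S.g ^ (u * N₀) = A₂ at hA₂
  have hdvd : A₂ ∣ A₁ := by
    rcases Nat.eq_zero_or_pos W with hW0 | hW0
    · exfalso
      rw [hW0, zero_add] at hA₁
      have h1 := aeval_monomial_curve α β hA₁.1
      have h2 := coeff_one_aeval_monomial_curve ha hb α β A₁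
      rw [h1, Polynomial.coeff_monomial_same] at h2
      exact hne hA₁ h2
    · have hB₁ : E.Konst (A₁ ^ W) (W * (W + 1)) := hA₁.pow W
      have hB₂ : E.Konst (A₂ ^ (W + 1)) (W * (W + 1)) := by
        rw [mul_comm]; exact hA₂.pow (W + 1)
      have hp := Konst.proportional hf hr ha hb hab hfw hθ hα hβ hB₁ hB₂
      have hd : A₂ ^ W ∣ C (aeval ![α, β] (A₂ ^ (W + 1))) * A₁ ^ W := by
        rw [← hp, pow_succ]
        exact (dvd_mul_right _ _).mul_left _
      have hunit : IsUnit (C (aeval ![α, β] (A₂ ^ (W + 1))) : MvPolynomial (Fin 2) k) :=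
        (isUnit_iff_ne_zero.mpr (hne hB₂)).map C
      rw [hunit.dvd_mul_left] at hd
      exact (IsIntegrallyClosed.pow_dvd_pow_iff hW0.ne').mp hd
  obtain ⟨ρ, rfl⟩ := hdvd
  have h1 := aeval_monomial_curve α β hA₁.1
  have h2 := coeff_one_aeval_monomial_curve ha hb α β ρ
  rw [map_mul, aeval_monomial_curve α β hA₂.1] at h1
  have h3 := congrArg (fun p => Polynomial.coeff p (1 + W)) h1
  rw [Polynomial.coeff_monomial_mul, h2, mul_zero, add_comm 1 W,
    Polynomial.coeff_monomial_same] at h3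
  exact hne hA₁ h3.symm
end GradedExp

section WeightFiltration
variable {k G : Type} [Field k] [AddCommMonoid G] (lam : G →+ ℝ)

/-- The elements of a monoid algebra all of whose terms have weight at most `γ`. -/
def weightLE (γ : ℝ) : AddSubgroup (AddMonoidAlgebra k G) where
  carrier := {p | ∀ g, p.coeff g ≠ 0 → lam g ≤ γ}
  zero_mem' := by simp
  add_mem' := fun {p q} hp hq g hg => by
    by_cases h : p.coeff g = 0
    · refine hq g fun h' => hg ?_
      simp [h, h']
    · exact hp g h
  neg_mem' := fun {p} hp g hg => hp g (by simpa using hg)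

/-- The part of weight `γ`. -/
def weightComp (γ : ℝ) : AddMonoidAlgebra k G →+ AddMonoidAlgebra k G where
  toFun p := .ofCoeff (p.coeff.filter fun g => lam g = γ)
  map_zero' := by ext; simp [Finsupp.filter_zero]
  map_add' p q := by
    ext g
    by_cases h : lam g = γ <;> simp [h]

theorem coeff_weightComp (γ : ℝ) (p : AddMonoidAlgebra k G) (g : G) :
    (weightComp lam γ p).coeff g = if lam g = γ then p.coeff g else 0 := by
  simp [weightComp, Finsupp.filter_apply]

theorem weightComp_single (γ : ℝ) (g : G) (c : k) :
    weightComp lam γ (.single g c) = if lam g = γ then .single g c else 0 := by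
  ext g'
  rw [coeff_weightComp]
  by_cases h : g = g'
  · subst h; split_ifs <;> simp
  · have : (AddMonoidAlgebra.single g c).coeff g' = 0 := by simp [h]
    rw [this]
    split_ifs <;> simp [h]

theorem single_mem_weightLE {γ : ℝ} {g : G} (h : lam g ≤ γ) (c : k) :
    AddMonoidAlgebra.single g c ∈ weightLE lam γ := by
  intro g' hg'
  have : g = g' := by
    by_contra hne
    exact hg' (by simp [hne])
  exact this ▸ h

theorem weightLE_mono {γ γ' : ℝ} (h : γ ≤ γ') :
    weightLE (k := k) lam γ ≤ weightLE lam γ' := fun _ hp g hg => (hp g hg).trans h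

theorem weightComp_eq_zero {γ γ' : ℝ} {p : AddMonoidAlgebra k G} (hp : p ∈ weightLE lam γ)
    (h : γ < γ') : weightComp lam γ' p = 0 := by
  ext g
  rw [coeff_weightComp]
  split_ifs with hg
  · by_contra hne
    exact absurd (hp g hne) (by rw [hg]; exact not_le.mpr h)
  · rfl

theorem eq_sum_single (p : AddMonoidAlgebra k G) :
    p = ∑ g ∈ p.coeff.support, .single g (p.coeff g) :=
  (AddMonoidAlgebra.sum_coeff_single p).symm

theorem mul_mem_weightLE {γ γ' : ℝ} {p q : AddMonoidAlgebra k G} (hp : p ∈ weightLE lam γ)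
    (hq : q ∈ weightLE lam γ') : p * q ∈ weightLE lam (γ + γ') := by
  rw [eq_sum_single p, eq_sum_single q, Finset.sum_mul_sum]
  refine sum_mem fun g hg => sum_mem fun h hh => ?_
  rw [AddMonoidAlgebra.single_mul_single]
  refine single_mem_weightLE lam ?_ _
  rw [map_add]
  exact add_le_add (hp g (Finsupp.mem_support_iff.mp hg)) (hq h (Finsupp.mem_support_iff.mp hh))

theorem weightComp_mul {γ γ' : ℝ} {p q : AddMonoidAlgebra k G} (hp : p ∈ weightLE lam γ)
    (hq : q ∈ weightLE lam γ') :
    weightComp lam (γ + γ') (p * q) = weightComp lam γ p * weightComp lam γ' q := by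
  conv_lhs => rw [eq_sum_single p, eq_sum_single q, Finset.sum_mul_sum]
  conv_rhs => rw [eq_sum_single p, eq_sum_single q, map_sum, map_sum, Finset.sum_mul_sum]
  simp only [map_sum]
  refine Finset.sum_congr rfl fun g hg => Finset.sum_congr rfl fun h hh => ?_
  have h1 := hp g (Finsupp.mem_support_iff.mp hg)
  have h2 := hq h (Finsupp.mem_support_iff.mp hh)
  rw [AddMonoidAlgebra.single_mul_single, weightComp_single, weightComp_single, weightComp_single,
    map_add]
  by_cases e1 : lam g = γ
  · by_cases e2 : lam h = γ'
    · rw [if_pos (by rw [e1, e2]), if_pos e1, if_pos e2, AddMonoidAlgebra.single_mul_single]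
    · rw [if_neg fun e => e2 (by linarith), if_neg e2, mul_zero]
  · rw [if_neg fun e => e1 (by linarith), if_neg e1, zero_mul]

end WeightFiltration

/-! ### The leading part of an exponential map -/

section LeadingPart
variable {k G D : Type} [Field k] [AddCommMonoid G] [CommRing D] [Algebra k D]
  (lam : G →+ ℝ) (φ : ExpMap k D) (ι : D →ₐ[k] AddMonoidAlgebra k G) (μ : ℝ)

/-- The elements `d` of weight at most `γ`, such that moreover the `n`-th coefficient of `φ d`
has weight at most `γ + n * μ`. -/
def goodLE (γ : ℝ) : AddSubgroup D where
  carrier := {d | ∀ n : ℕ, ι ((φ.toAlgHom d).coeff n) ∈ weightLE lam (γ + n * μ)}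
  zero_mem' n := by simp
  add_mem' hp hq n := by
    rw [map_add, Polynomial.coeff_add, map_add]
    exact add_mem (hp n) (hq n)
  neg_mem' hp n := by
    rw [map_neg, Polynomial.coeff_neg, map_neg]
    exact neg_mem (hp n)

/-- The leading part of `φ d`. -/
def lead (γ : ℝ) : D →+ Polynomial (AddMonoidAlgebra k G) where
  toFun d := ∑ n ∈ Finset.range ((φ.toAlgHom d).natDegree + 1),
    Polynomial.monomial n (weightComp lam (γ + n * μ) (ι ((φ.toAlgHom d).coeff n)))
  map_zero' := by simp
  map_add' := fun p q => by
    ext1 l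
    have key : ∀ d, (∑ n ∈ Finset.range ((φ.toAlgHom d).natDegree + 1),
        Polynomial.monomial n (weightComp lam (γ + n * μ) (ι ((φ.toAlgHom d).coeff n)))).coeff l
        = weightComp lam (γ + l * μ) (ι ((φ.toAlgHom d).coeff l)) := by
      intro d
      simp only [Polynomial.finsetSum_coeff, Polynomial.coeff_monomial]
      rw [Finset.sum_ite_eq']
      split_ifs with h
      · rfl
      · rw [Polynomial.coeff_eq_zero_of_natDegree_lt (by simpa using h), map_zero, map_zero]
    rw [Polynomial.coeff_add, key, key, key]
    simp

theorem coeff_lead (γ : ℝ) (d : D) (l : ℕ) : (lead lam φ ι μ γ d).coeff l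
    = weightComp lam (γ + l * μ) (ι ((φ.toAlgHom d).coeff l)) := by
  simp only [lead, AddMonoidHom.coe_mk, ZeroHom.coe_mk, Polynomial.finsetSum_coeff,
    Polynomial.coeff_monomial]
  rw [Finset.sum_ite_eq']
  split_ifs with h
  · rfl
  · rw [Polynomial.coeff_eq_zero_of_natDegree_lt (by simpa using h), map_zero, map_zero]

theorem coeff_zero_eq (d : D) : (φ.toAlgHom d).coeff 0 = d := by
  rw [Polynomial.coeff_zero_eq_eval_zero, φ.eval_zero]

theorem coeff_zero_lead (γ : ℝ) (d : D) :
    (lead lam φ ι μ γ d).coeff 0 = weightComp lam γ (ι d) := by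
  rw [coeff_lead, coeff_zero_eq]; simp

variable {μ}

theorem goodLE_mono {γ γ' : ℝ} (h : γ ≤ γ') : goodLE lam φ ι μ γ ≤ goodLE lam φ ι μ γ' :=
  fun _ hd n => weightLE_mono lam (by linarith) (hd n)

theorem lead_eq_zero {γ γ' : ℝ} {d : D} (hd : d ∈ goodLE lam φ ι μ γ) (h : γ < γ') :
    lead lam φ ι μ γ' d = 0 := by
  ext1 l
  rw [coeff_lead, weightComp_eq_zero lam (hd l) (by linarith), Polynomial.coeff_zero]

theorem mul_mem_goodLE {γ γ' : ℝ} {d d' : D} (hd : d ∈ goodLE lam φ ι μ γ)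
    (hd' : d' ∈ goodLE lam φ ι μ γ') : d * d' ∈ goodLE lam φ ι μ (γ + γ') := by
  intro n
  rw [map_mul, Polynomial.coeff_mul, map_sum]
  refine sum_mem fun x hx => ?_
  rw [map_mul]
  have := mul_mem_weightLE lam (hd x.1) (hd' x.2)
  convert this using 2
  rw [← Finset.HasAntidiagonal.mem_antidiagonal.mp hx]
  push_cast; ring

theorem lead_mul {γ γ' : ℝ} {d d' : D} (hd : d ∈ goodLE lam φ ι μ γ)
    (hd' : d' ∈ goodLE lam φ ι μ γ') :
    lead lam φ ι μ (γ + γ') (d * d') = lead lam φ ι μ γ d * lead lam φ ι μ γ' d' := by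
  ext1 n
  rw [coeff_lead, map_mul, Polynomial.coeff_mul, Polynomial.coeff_mul, map_sum, map_sum]
  refine Finset.sum_congr rfl fun x hx => ?_
  rw [map_mul, coeff_lead, coeff_lead, ← weightComp_mul lam (hd x.1) (hd' x.2)]
  congr 2
  rw [← Finset.HasAntidiagonal.mem_antidiagonal.mp hx]
  push_cast; ring

theorem algebraMap_mem_goodLE (c : k) : algebraMap k D c ∈ goodLE lam φ ι μ 0 := by
  intro n
  rw [AlgHom.commutes, Polynomial.algebraMap_apply, Polynomial.coeff_C]
  split_ifs with h
  · subst h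
    rw [AlgHom.commutes, AddMonoidAlgebra.coe_algebraMap]
    exact single_mem_weightLE lam (by simp) _
  · simp

theorem lead_algebraMap (c : k) : lead lam φ ι μ 0 (algebraMap k D c) = algebraMap k _ c := by
  ext1 n
  rw [coeff_lead, AlgHom.commutes, Polynomial.algebraMap_apply, Polynomial.algebraMap_apply,
    Polynomial.coeff_C, Polynomial.coeff_C]
  split_ifs with h
  · subst h
    rw [AlgHom.commutes, AddMonoidAlgebra.coe_algebraMap]
    simp [weightComp_single]
  · simp

theorem pow_mem_goodLE {γ : ℝ} {d : D} (hd : d ∈ goodLE lam φ ι μ γ) (n : ℕ) :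
    d ^ n ∈ goodLE lam φ ι μ (n * γ) ∧
      lead lam φ ι μ (n * γ) (d ^ n) = lead lam φ ι μ γ d ^ n := by
  induction n with
  | zero =>
    have h1 := algebraMap_mem_goodLE lam φ ι (μ := μ) 1
    have h2 := lead_algebraMap lam φ ι (μ := μ) 1
    rw [map_one] at h1
    rw [map_one (algebraMap k D), map_one (algebraMap k _)] at h2
    simpa using ⟨h1, h2⟩
  | succ n ih =>
    have e : ((n + 1 : ℕ) : ℝ) * γ = n * γ + γ := by push_cast; ring
    rw [e, pow_succ, pow_succ]
    exact ⟨mul_mem_goodLE lam φ ι ih.1 hd, by rw [lead_mul lam φ ι ih.1 hd, ih.2]⟩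

theorem prod_mem_goodLE {I : Type} (s : Finset I) {γ : I → ℝ} {d : I → D}
    (hd : ∀ l, d l ∈ goodLE lam φ ι μ (γ l)) :
    ∏ l ∈ s, d l ∈ goodLE lam φ ι μ (∑ l ∈ s, γ l) ∧
      lead lam φ ι μ (∑ l ∈ s, γ l) (∏ l ∈ s, d l) = ∏ l ∈ s, lead lam φ ι μ (γ l) (d l) := by
  classical
  induction s using Finset.induction_on with
  | empty => simpa using pow_mem_goodLE lam φ ι (algebraMap_mem_goodLE lam φ ι (μ := μ) 1) 0
  | insert i s hi ih =>
    rw [Finset.prod_insert hi, Finset.sum_insert hi, Finset.prod_insert hi]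
    exact ⟨mul_mem_goodLE lam φ ι (hd i) ih.1, by rw [lead_mul lam φ ι (hd i) ih.1, ih.2]⟩

/-- The coefficients of an exponential map compose like divided powers. -/
theorem coeff_coeff (d : D) (n l : ℕ) :
    (φ.toAlgHom ((φ.toAlgHom d).coeff n)).coeff l
      = ((n + l).choose l : D) * (φ.toAlgHom d).coeff (n + l) := by
  have h := congrArg (fun p => (p.coeff l).coeff n) (φ.comp_add d)
  simp only [Polynomial.eval₂_eq_sum, Polynomial.sum_def, Polynomial.finsetSum_coeff] at h
  have key₁ : ∀ e : D, ∀ i, ((((Polynomial.mapRingHom (Polynomial.C (R := D))).comp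
      φ.toAlgHom.toRingHom) e * Polynomial.C Polynomial.X ^ i).coeff l).coeff n
      = if n = i then (φ.toAlgHom e).coeff l else 0 := by
    intro e i
    rw [← Polynomial.C_pow, Polynomial.coeff_mul_C, RingHom.comp_apply, Polynomial.coe_mapRingHom,
      Polynomial.coeff_map, Polynomial.coeff_C_mul, Polynomial.coeff_X_pow]
    split_ifs <;> simp
  have key₂ : ∀ e : D, ∀ i, ((((Polynomial.C (R := Polynomial D)).comp (Polynomial.C (R := D))) e *
      (Polynomial.C Polynomial.X + Polynomial.X) ^ i).coeff l).coeff n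
      = if n + l = i then ((n + l).choose l : D) * e else 0 := by
    intro e i
    rw [add_comm (Polynomial.C Polynomial.X), RingHom.comp_apply, Polynomial.coeff_C_mul,
      Polynomial.coeff_X_add_C_pow, Polynomial.coeff_C_mul, Polynomial.coeff_mul_natCast,
      Polynomial.coeff_X_pow]
    by_cases hi : n + l = i
    · subst hi; simp [mul_comm]
    · rw [if_neg hi]
      by_cases hl : i < l
      · rw [Nat.choose_eq_zero_of_lt hl]; simp
      · rw [if_neg (by omega)]; simp
  simp only [key₁, key₂] at h
  rw [Finset.sum_ite_eq, Finset.sum_ite_eq] at h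
  convert h using 1 <;> split_ifs with h' <;> first | rfl | skip
  · rw [Polynomial.notMem_support_iff.mp h']; simp
  · rw [Polynomial.notMem_support_iff.mp h']; simp

theorem coeff_mem_goodLE {γ : ℝ} {d : D} (hd : d ∈ goodLE lam φ ι μ γ) (n : ℕ) :
    (φ.toAlgHom d).coeff n ∈ goodLE lam φ ι μ (γ + n * μ) := by
  intro l
  rw [coeff_coeff, map_mul, map_natCast, ← nsmul_eq_mul _ (ι _)]
  refine AddSubgroup.nsmul_mem (weightLE (k := k) lam _) ?_ _
  have := hd (n + l)
  convert this using 2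
  push_cast; ring

theorem coeff_lead_coeff (γ : ℝ) (d : D) (n l : ℕ) :
    (lead lam φ ι μ (γ + n * μ) ((φ.toAlgHom d).coeff n)).coeff l
      = ((n + l).choose l : AddMonoidAlgebra k G) * (lead lam φ ι μ γ d).coeff (n + l) := by
  rw [coeff_lead, coeff_coeff, coeff_lead, map_mul, map_natCast,
    ← nsmul_eq_mul _ (ι _), map_nsmul, nsmul_eq_mul]
  congr 3
  push_cast; ring

end LeadingPart

/-! ### Polynomials in elements of known weight -/

section LeadingPartAeval
variable {k G D σ : Type} [Field k] [AddCommMonoid G] [CommRing D] [Algebra k D] [Fintype σ]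
  (lam : G →+ ℝ) (φ : ExpMap k D) (ι : D →ₐ[k] AddMonoidAlgebra k G) {μ : ℝ}

theorem aeval_monomial_mem_goodLE {v : σ → D} {w : σ → ℝ}
    (hv : ∀ s, v s ∈ goodLE lam φ ι μ (w s)) (d : σ →₀ ℕ) (c : k) :
    aeval v (monomial d c) ∈ goodLE lam φ ι μ (∑ s, d s * w s) ∧
      lead lam φ ι μ (∑ s, d s * w s) (aeval v (monomial d c))
        = aeval (fun s => lead lam φ ι μ (w s) (v s)) (monomial d c) := by
  rw [aeval_monomial, aeval_monomial, Finsupp.prod_fintype _ _ (fun _ => pow_zero _),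
    Finsupp.prod_fintype _ _ (fun _ => pow_zero _)]
  have h1 := prod_mem_goodLE lam φ ι Finset.univ
    (fun s => (pow_mem_goodLE lam φ ι (hv s) (d s)).1)
  have h2 := algebraMap_mem_goodLE lam φ ι (μ := μ) c
  have h3 := mul_mem_goodLE lam φ ι h2 h1.1
  have h4 := lead_mul lam φ ι h2 h1.1
  rw [zero_add] at h3 h4
  refine ⟨h3, ?_⟩
  rw [h4, h1.2, lead_algebraMap]
  congr 1
  exact Finset.prod_congr rfl fun s _ => (pow_mem_goodLE lam φ ι (hv s) (d s)).2

theorem aeval_mem_goodLE {v : σ → D} {w : σ → ℝ} (hv : ∀ s, v s ∈ goodLE lam φ ι μ (w s))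
    {p : MvPolynomial σ k} {ν : ℝ} (hp : ∀ d ∈ p.support, ∑ s, d s * w s ≤ ν) :
    aeval v p ∈ goodLE lam φ ι μ ν ∧ lead lam φ ι μ ν (aeval v p)
      = ∑ d ∈ p.support, if ∑ s, d s * w s = ν then
          aeval (fun s => lead lam φ ι μ (w s) (v s)) (monomial d (p.coeff d)) else 0 := by
  have e : aeval v p = ∑ d ∈ p.support, aeval v (monomial d (p.coeff d)) := by
    conv_lhs => rw [p.as_sum, map_sum]
  rw [e, map_sum]
  refine ⟨sum_mem fun d hd => goodLE_mono lam φ ι (hp d hd)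
    (aeval_monomial_mem_goodLE lam φ ι hv d _).1, Finset.sum_congr rfl fun d hd => ?_⟩
  have := aeval_monomial_mem_goodLE lam φ ι hv d (p.coeff d)
  split_ifs with h
  · rw [← h, this.2]
  · exact lead_eq_zero lam φ ι this.1 (lt_of_le_of_ne (hp d hd) h)

end LeadingPartAeval

/-! ### Presentations inside a Laurent polynomial ring -/

/-- Laurent polynomials in `m` variables over the polynomial ring in two variables. -/
abbrev Laurent (k : Type) [Field k] (m : ℕ) := AddMonoidAlgebra k ((Fin m → ℤ) × (Fin 2 →₀ ℕ))

/-- The weight on exponents given by `-θ l` on the Laurent variables and `a`, `b` on the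
polynomial variables. -/
def lamWeight {m : ℕ} (θ : Fin m → ℝ) (a b : ℕ) : (Fin m → ℤ) × (Fin 2 →₀ ℕ) →+ ℝ where
  toFun g := -∑ l, (g.1 l : ℝ) * θ l + (Finsupp.weight ![a, b] g.2 : ℕ)
  map_zero' := by simp
  map_add' g g' := by
    simp only [Prod.fst_add, Prod.snd_add, Pi.add_apply, Int.cast_add, add_mul,
      Finset.sum_add_distrib, map_add, Nat.cast_add]
    ring

/-- A ring generated by `x`, `y`, `z`, `t` with `x ^ r * y = F x z t`, mapped to Laurent
polynomials so that `x`, `z`, `t` become the variables. -/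
structure LaurentPresentation (k D : Type) [Field k] [CommRing D] [Algebra k D] {m : ℕ}
    (r : Fin m → ℕ) (F : MvPolynomial (Fin m ⊕ Fin 2) k) where
  x : Fin m → D
  y : D
  z : D
  t : D
  rel : (∏ l, x l ^ r l) * y = aeval (Sum.elim x ![z, t]) F
  adjoin_eq_top : Algebra.adjoin k (Set.range x ∪ {y, z, t}) = ⊤
  ι : D →ₐ[k] Laurent k m
  ι_x : ∀ l, ι (x l) = .single (Pi.single l 1, 0) 1
  ι_z : ι z = .single (0, Finsupp.single 0 1) 1
  ι_t : ι t = .single (0, Finsupp.single 1 1) 1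

namespace LaurentPresentation
variable {k D : Type} [Field k] [CommRing D] [Algebra k D] {m : ℕ}
  {r : Fin m → ℕ} {F : MvPolynomial (Fin m ⊕ Fin 2) k} (E : LaurentPresentation k D r F)

/-- Polynomials in `z` and `t`. -/
def zt : MvPolynomial (Fin 2) k →ₐ[k] D := aeval ![E.z, E.t]

theorem ι_zt (g : MvPolynomial (Fin 2) k) :
    E.ι (E.zt g) = ∑ d ∈ g.support, .single (0, d) (g.coeff d) := by
  conv_lhs => rw [g.as_sum, map_sum, map_sum]
  refine Finset.sum_congr rfl fun d hd => ?_
  rw [zt, aeval_monomial, Finsupp.prod_fintype _ _ (fun _ => pow_zero _), Fin.prod_univ_two]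
  simp only [Matrix.cons_val_zero, Matrix.cons_val_one, map_mul, map_pow, E.ι_z, E.ι_t,
    AlgHom.commutes, AddMonoidAlgebra.coe_algebraMap, AddMonoidAlgebra.single_pow,
    AddMonoidAlgebra.single_mul_single]
  simp only [Function.comp_apply, Algebra.algebraMap_self, RingHom.id_apply, one_pow, mul_one]
  rw [AddMonoidAlgebra.single_mul_single, mul_one, zero_add]
  congr 1
  refine Prod.ext (by simp) ?_
  ext s
  fin_cases s <;> simp

theorem ι_zt_injective : Function.Injective fun g => E.ι (E.zt g) := by
  intro g g' h
  have key : ∀ (p : MvPolynomial (Fin 2) k) d, (E.ι (E.zt p)).coeff (0, d) = p.coeff d := by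
    intro p d
    rw [ι_zt, AddMonoidAlgebra.coeff_sum, Finsupp.finsetSum_apply]
    rw [Finset.sum_eq_single d]
    · simp
    · intro d' _ hne
      simp [hne]
    · intro h
      rw [notMem_support_iff.mp h]; simp
  ext d
  rw [← key, ← key]
  exact congrArg (fun p : Laurent k m => p.coeff (0, d)) h

end LaurentPresentation

/-- The weights of the generators of a presentation, for an exponential map of slope `μ`. -/
structure GoodGenerators {k D : Type} [Field k] [CommRing D] [Algebra k D] {m : ℕ}
    {r : Fin m → ℕ} {F : MvPolynomial (Fin m ⊕ Fin 2) k} (E : LaurentPresentation k D r F)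
    (φ : ExpMap k D) (θ : Fin m → ℝ) (a b wf : ℕ) (μ : ℝ) : Prop where
  x_mem : ∀ l, E.x l ∈ goodLE (lamWeight θ a b) φ E.ι μ (-θ l)
  y_mem : E.y ∈ goodLE (lamWeight θ a b) φ E.ι μ (wf + ∑ l, (r l : ℝ) * θ l)
  z_mem : E.z ∈ goodLE (lamWeight θ a b) φ E.ι μ a
  t_mem : E.t ∈ goodLE (lamWeight θ a b) φ E.ι μ b

theorem fOf_monomial {k : Type} [CommRing k] {m : ℕ} (d : Fin m ⊕ Fin 2 →₀ ℕ) (c : k) :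
    (fOf k m (monomial d c) = 0 ∧ ∃ l, d (Sum.inl l) ≠ 0) ∨
      ((∀ l, d (Sum.inl l) = 0) ∧ ∃ e : Fin 2 →₀ ℕ, fOf k m (monomial d c) = monomial e c ∧
        ∀ s, e s = d (Sum.inr s)) := by
  have h : fOf k m (monomial d c)
      = C c * ((∏ l, (0 : MvPolynomial (Fin 2) k) ^ d (Sum.inl l)) * ∏ s, X s ^ d (Sum.inr s)) := by
    rw [fOf, aeval_monomial, Finsupp.prod_fintype _ _ (fun _ => pow_zero _),
      Fintype.prod_sum_type]
    rfl
  by_cases hd : ∃ l, d (Sum.inl l) ≠ 0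
  · left
    obtain ⟨l, hl⟩ := hd
    refine ⟨?_, l, hl⟩
    rw [h, Finset.prod_eq_zero (Finset.mem_univ l) (zero_pow hl), zero_mul, mul_zero]
  · right
    push Not at hd
    refine ⟨hd, Finsupp.equivFunOnFinite.symm fun s => d (Sum.inr s), ?_, fun s => rfl⟩
    rw [h, monomial_eq, Finsupp.prod_fintype _ _ (fun _ => pow_zero _)]
    simp [hd]

section WeightedPart
variable {k : Type} [Field k] {m : ℕ} {θ : Fin m → ℝ} {a b : ℕ}

/-- The weights of the variables `x`, `z`, `t`. -/
def varWeight (θ : Fin m → ℝ) (a b : ℕ) : Fin m ⊕ Fin 2 → ℝ :=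
  Sum.elim (fun l => -θ l) ![(a : ℝ), (b : ℝ)]

theorem sum_varWeight (d : Fin m ⊕ Fin 2 →₀ ℕ) : ∑ s, d s * varWeight θ a b s
    = -∑ l, (d (Sum.inl l) : ℝ) * θ l + (d (Sum.inr 0) * a + d (Sum.inr 1) * b : ℕ) := by
  simp [varWeight, Fintype.sum_sum_type, Fin.sum_univ_two]

/-- Every term of `F` has weight at most `wf`, the terms involving `x` having smaller weight. -/
def TermsLE (F : MvPolynomial (Fin m ⊕ Fin 2) k) (θ : Fin m → ℝ) (a b wf : ℕ) : Prop :=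
  ∀ d ∈ F.support, ∑ s, d s * varWeight θ a b s ≤ wf ∧
    ((∃ l, d (Sum.inl l) ≠ 0) → ∑ s, d s * varWeight θ a b s < wf)

end WeightedPart

section GoodGeneratorsLead
variable {k D : Type} [Field k] [CommRing D] [Algebra k D] {m : ℕ}
    {r : Fin m → ℕ} {F : MvPolynomial (Fin m ⊕ Fin 2) k} {E : LaurentPresentation k D r F}
    {φ : ExpMap k D} {θ : Fin m → ℝ} {a b wf : ℕ} {μ : ℝ}

theorem lead_aeval_termsLE (hF : TermsLE F θ a b wf)
    (hx : ∀ l, E.x l ∈ goodLE (lamWeight θ a b) φ E.ι μ (-θ l))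
    (hz : E.z ∈ goodLE (lamWeight θ a b) φ E.ι μ a)
    (ht : E.t ∈ goodLE (lamWeight θ a b) φ E.ι μ b) :
    aeval (Sum.elim E.x ![E.z, E.t]) F ∈ goodLE (lamWeight θ a b) φ E.ι μ wf ∧
    lead (lamWeight θ a b) φ E.ι μ wf (aeval (Sum.elim E.x ![E.z, E.t]) F)
      = aeval ![lead (lamWeight θ a b) φ E.ι μ a E.z, lead (lamWeight θ a b) φ E.ι μ b E.t]
          (weightedHomogeneousComponent ![a, b] wf (fOf k m F)) := by
  have hv : ∀ s, (Sum.elim E.x ![E.z, E.t] : Fin m ⊕ Fin 2 → D) s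
      ∈ goodLE (lamWeight θ a b) φ E.ι μ (varWeight θ a b s) := by
    rintro (l | s)
    · exact hx l
    · fin_cases s
      · exact hz
      · exact ht
  obtain ⟨h1, h2⟩ := aeval_mem_goodLE (lamWeight θ a b) φ E.ι hv (p := F) (ν := wf)
    (fun d hd => (hF d hd).1)
  refine ⟨h1, ?_⟩
  have e : fOf k m F = ∑ d ∈ F.support, fOf k m (monomial d (F.coeff d)) := by
    simp only [fOf]
    rw [← map_sum, ← F.as_sum]
  rw [h2, e, map_sum, map_sum]
  refine Finset.sum_congr rfl fun d hd => ?_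
  rcases fOf_monomial d (F.coeff d) with ⟨h3, h4⟩ | ⟨h3, e, h4, h5⟩
  · rw [if_neg ((hF d hd).2 h4).ne, h3, map_zero, map_zero]
  · rw [h4, sum_varWeight]
    have hw : Finsupp.weight ![a, b] e = d (Sum.inr 0) * a + d (Sum.inr 1) * b := by
      rw [weight_pair, h5, h5]
    have hh := isWeightedHomogeneous_monomial ![a, b] e (F.coeff d) hw
    simp only [h3, Nat.cast_zero, zero_mul, Finset.sum_const_zero, neg_zero, zero_add]
    split_ifs with hc
    · rw [Nat.cast_inj] at hc
      rw [hc] at hh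
      rw [hh.weightedHomogeneousComponent_same, aeval_monomial,
        aeval_monomial, Finsupp.prod_fintype _ _ (fun _ => pow_zero _),
        Finsupp.prod_fintype _ _ (fun _ => pow_zero _), Fintype.prod_sum_type, Fin.prod_univ_two,
        Fin.prod_univ_two, h5, h5]
      simp [h3, varWeight]
    · rw [hh.weightedHomogeneousComponent_ne wf fun h => hc (by rw [h]),
        map_zero]

namespace GoodGenerators
theorem lead_rel (H : GoodGenerators E φ θ a b wf μ) (hF : TermsLE F θ a b wf) :
    (∏ l, lead (lamWeight θ a b) φ E.ι μ (-θ l) (E.x l) ^ r l)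
        * lead (lamWeight θ a b) φ E.ι μ (wf + ∑ l, (r l : ℝ) * θ l) E.y
      = aeval ![lead (lamWeight θ a b) φ E.ι μ a E.z, lead (lamWeight θ a b) φ E.ι μ b E.t]
          (weightedHomogeneousComponent ![a, b] wf (fOf k m F)) := by
  rw [← (lead_aeval_termsLE hF H.x_mem H.z_mem H.t_mem).2, ← E.rel]
  have h1 := prod_mem_goodLE (lamWeight θ a b) φ E.ι Finset.univ
    (fun l => (pow_mem_goodLE _ _ _ (H.x_mem l) (r l)).1)
  have h2 := lead_mul _ _ _ h1.1 H.y_mem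
  rw [h1.2] at h2
  rw [show ∑ l, (r l : ℝ) * -θ l + (wf + ∑ l, (r l : ℝ) * θ l) = wf by simp] at h2
  rw [h2]
  congr 1
  exact Finset.prod_congr rfl fun l _ => (pow_mem_goodLE _ _ _ (H.x_mem l) (r l)).2.symm

/-- The weight of `x ^ i * y ^ j * g`. -/
theorem mul_mem_goodLE (H : GoodGenerators E φ θ a b wf μ) (i : Fin m → ℕ) (j : ℕ) {ν : ℝ} {d : D}
    (hd : d ∈ goodLE (lamWeight θ a b) φ E.ι μ ν) :
    (∏ l, E.x l ^ i l) * E.y ^ j * d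
        ∈ goodLE (lamWeight θ a b) φ E.ι μ (monWeight r wf θ i j 0 + ν) ∧
    lead (lamWeight θ a b) φ E.ι μ (monWeight r wf θ i j 0 + ν) ((∏ l, E.x l ^ i l) * E.y ^ j * d)
      = (∏ l, lead (lamWeight θ a b) φ E.ι μ (-θ l) (E.x l) ^ i l)
        * lead (lamWeight θ a b) φ E.ι μ (wf + ∑ l, (r l : ℝ) * θ l) E.y ^ j
        * lead (lamWeight θ a b) φ E.ι μ ν d := by
  have h1 := prod_mem_goodLE (lamWeight θ a b) φ E.ι Finset.univ
    (fun l => (pow_mem_goodLE _ _ _ (H.x_mem l) (i l)).1)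
  have h2 := pow_mem_goodLE _ _ _ H.y_mem j
  have h3 := _root_.mul_mem_goodLE _ _ _ h1.1 h2.1
  have h4 := lead_mul _ _ _ h1.1 h2.1
  have e : ∑ l, (i l : ℝ) * -θ l + j * (wf + ∑ l, (r l : ℝ) * θ l) = monWeight r wf θ i j 0 := by
    simp [monWeight]
  rw [e] at h3 h4
  refine ⟨_root_.mul_mem_goodLE _ _ _ h3 hd, ?_⟩
  rw [lead_mul _ _ _ h3 hd, h4, h1.2, h2.2]
  congr 2
  exact Finset.prod_congr rfl fun l _ => (pow_mem_goodLE _ _ _ (H.x_mem l) (i l)).2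

theorem zt_mem_goodLE (H : GoodGenerators E φ θ a b wf μ) {g : MvPolynomial (Fin 2) k} {ν : ℝ}
    (hg : ∀ d ∈ g.support, (Finsupp.weight ![a, b] d : ℝ) ≤ ν) :
    E.zt g ∈ goodLE (lamWeight θ a b) φ E.ι μ ν ∧
    ((∀ d ∈ g.support, (Finsupp.weight ![a, b] d : ℝ) ≠ ν) →
      lead (lamWeight θ a b) φ E.ι μ ν (E.zt g) = 0) ∧
    ∀ N : ℕ, ν = N → lead (lamWeight θ a b) φ E.ι μ ν (E.zt g)
      = aeval ![lead (lamWeight θ a b) φ E.ι μ a E.z, lead (lamWeight θ a b) φ E.ι μ b E.t]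
          (weightedHomogeneousComponent ![a, b] N g) := by
  have hv : ∀ s, (![E.z, E.t] : Fin 2 → D) s
      ∈ goodLE (lamWeight θ a b) φ E.ι μ ((![(a : ℝ), (b : ℝ)] : Fin 2 → ℝ) s) := by
    intro s
    fin_cases s
    · exact H.z_mem
    · exact H.t_mem
  have hw : ∀ d : Fin 2 →₀ ℕ, ∑ s, d s * (![(a : ℝ), (b : ℝ)] : Fin 2 → ℝ) s
      = (Finsupp.weight ![a, b] d : ℕ) := by
    intro d
    rw [weight_pair, Fin.sum_univ_two]
    simp
  obtain ⟨h1, h2⟩ := aeval_mem_goodLE (lamWeight θ a b) φ E.ι hv (p := g) (ν := ν)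
    (fun d hd => by rw [hw]; exact hg d hd)
  refine ⟨h1, fun hne => ?_, fun N hN => ?_⟩
  · rw [LaurentPresentation.zt, h2]
    exact Finset.sum_eq_zero fun d hd => if_neg (by rw [hw]; exact hne d hd)
  · rw [LaurentPresentation.zt, h2, weightedHomogeneousComponent_apply, map_sum,
      Finset.sum_filter]
    refine Finset.sum_congr rfl fun d _ => ?_
    rw [hw, hN]
    simp only [Nat.cast_inj]
    split_ifs
    · congr 2
      funext s
      fin_cases s <;> rfl
    · rfl

end GoodGenerators
end GoodGeneratorsLead

/-! ### Normal forms -/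

section NormalForm
variable {m : ℕ} (r : Fin m → ℕ)

/-- The least `j` such that `i + j * r` has no negative entries. -/
def yExp (i : Fin m → ℤ) : ℕ := sInf {j : ℕ | ∀ l, 0 ≤ i l + j * r l}

/-- The exponent of `x` in the normal form of the Laurent monomial `i`. -/
def xExp (i : Fin m → ℤ) (l : Fin m) : ℕ := (i l + yExp r i * r l).toNat

variable {r}

theorem cast_xExp (hr : ∀ l, 0 < r l) (i : Fin m → ℤ) (l : Fin m) :
    (xExp r i l : ℤ) = i l + yExp r i * r l := by
  have hne : {j : ℕ | ∀ l, 0 ≤ i l + j * r l}.Nonempty := by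
    refine ⟨∑ l, (i l).natAbs, fun l => ?_⟩
    have h1 : (i l).natAbs ≤ ∑ l, (i l).natAbs :=
      Finset.single_le_sum (f := fun l => (i l).natAbs) (fun _ _ => Nat.zero_le _)
        (Finset.mem_univ l)
    have h2 : (i l).natAbs * 1 ≤ (∑ l, (i l).natAbs) * r l := Nat.mul_le_mul h1 (hr l)
    have h3 : ((i l).natAbs : ℤ) ≤ ((∑ l, (i l).natAbs : ℕ) : ℤ) * r l := by
      rw [mul_one] at h2
      exact_mod_cast h2
    have h4 := neg_abs_le (i l)
    rw [Int.abs_eq_natAbs] at h4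
    linarith
  exact Int.toNat_of_nonneg (Nat.sInf_mem hne l)

theorem yExp_le {i : Fin m → ℤ} {j : ℕ} (h : ∀ l, 0 ≤ i l + j * r l) : yExp r i ≤ j :=
  Nat.sInf_le h

theorem yExp_eq_zero {i : Fin m → ℤ} (h : ∀ l, 0 ≤ i l) : yExp r i = 0 :=
  Nat.le_zero.mp (yExp_le (by simpa using h))

theorem eq_of_xExp_eq (hr : ∀ l, 0 < r l) {i i' : Fin m → ℤ}
    (h : ∀ l, xExp r i l + yExp r i' * r l = xExp r i' l + yExp r i * r l) : i = i' := by
  funext l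
  have h1 := cast_xExp hr i l
  have h2 := cast_xExp hr i' l
  have h3 : (xExp r i l : ℤ) + yExp r i' * r l = xExp r i' l + yExp r i * r l := by
    exact_mod_cast h l
  linarith

end NormalForm

namespace LaurentPresentation
variable {k D : Type} [Field k] [CommRing D] [Algebra k D] {m : ℕ}
  {r : Fin m → ℕ} {F : MvPolynomial (Fin m ⊕ Fin 2) k} (E : LaurentPresentation k D r F)

/-- The element `∑ i, x ^ i * g i` for a finitely supported family `g` of polynomials in `z`, `t`,
where `x ^ i` is rewritten with a power of `y` when `i` has negative entries. -/
def normalForm : ((Fin m → ℤ) →₀ MvPolynomial (Fin 2) k) →ₗ[k] D :=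
  Finsupp.lsum k fun i =>
    (LinearMap.mulLeft k ((∏ l, E.x l ^ xExp r i l) * E.y ^ yExp r i)).comp E.zt.toLinearMap

theorem normalForm_apply (g : (Fin m → ℤ) →₀ MvPolynomial (Fin 2) k) :
    E.normalForm g
      = ∑ i ∈ g.support, (∏ l, E.x l ^ xExp r i l) * E.y ^ yExp r i * E.zt (g i) := by
  simp [normalForm, Finsupp.sum, mul_assoc]

theorem aeval_eq_sum (p : MvPolynomial (Fin m ⊕ Fin 2) k) : aeval (Sum.elim E.x ![E.z, E.t]) p
    = ∑ d ∈ p.support, (∏ l, E.x l ^ d (Sum.inl l))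
      * E.zt (C (p.coeff d) * (X 0 ^ d (Sum.inr 0) * X 1 ^ d (Sum.inr 1))) := by
  conv_lhs => rw [p.as_sum, map_sum]
  refine Finset.sum_congr rfl fun d _ => ?_
  rw [aeval_monomial, Finsupp.prod_fintype _ _ (fun _ => pow_zero _), Fintype.prod_sum_type,
    Fin.prod_univ_two]
  simp only [Sum.elim_inl, Sum.elim_inr, zt, map_mul, map_pow, aeval_X, Matrix.cons_val_zero,
    Matrix.cons_val_one, algHom_C]
  ring

theorem mul_mem_range_normalForm (hr : ∀ l, 0 < r l) (j : ℕ) (e : Fin m → ℕ)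
    (g : MvPolynomial (Fin 2) k) :
    (∏ l, E.x l ^ e l) * E.y ^ j * E.zt g ∈ LinearMap.range E.normalForm := by
  induction j generalizing e g with
  | zero =>
    refine ⟨Finsupp.single (fun l => (e l : ℤ)) g, ?_⟩
    have h0 : yExp r (fun l => (e l : ℤ)) = 0 := yExp_eq_zero fun l => by positivity
    simp [normalForm, xExp, h0]
  | succ j ih =>
    by_cases h : yExp r (fun l => (e l : ℤ) - (j + 1 : ℕ) * r l) = j + 1
    · refine ⟨Finsupp.single (fun l => (e l : ℤ) - (j + 1 : ℕ) * r l) g, ?_⟩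
      push_cast at h
      simp [normalForm, xExp, h, mul_assoc]
    · have hle : yExp r (fun l => (e l : ℤ) - (j + 1 : ℕ) * r l) ≤ j + 1 :=
        yExp_le fun l => by simp
      have her : ∀ l, r l ≤ e l := by
        intro l
        have h1 := cast_xExp hr (fun l => (e l : ℤ) - (j + 1 : ℕ) * r l) l
        have h2 : (yExp r (fun l => (e l : ℤ) - (j + 1 : ℕ) * r l) : ℤ) ≤ j := by
          have := lt_of_le_of_ne hle h
          omega
        have h3 := mul_le_mul_of_nonneg_right h2 (Int.natCast_nonneg (r l))
        have h4 : (0 : ℤ) ≤ xExp r (fun l => (e l : ℤ) - (j + 1 : ℕ) * r l) l := by positivity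
        push_cast at h1 h3 h4
        have : (r l : ℤ) ≤ e l := by linarith
        exact_mod_cast this
      have hx : ∏ l, E.x l ^ e l = (∏ l, E.x l ^ (e l - r l)) * ∏ l, E.x l ^ r l := by
        rw [← Finset.prod_mul_distrib]
        exact Finset.prod_congr rfl fun l _ => by rw [← pow_add, Nat.sub_add_cancel (her l)]
      have : (∏ l, E.x l ^ e l) * E.y ^ (j + 1) * E.zt g
          = ∑ d ∈ F.support, (∏ l, E.x l ^ ((e l - r l) + d (Sum.inl l))) * E.y ^ j
            * E.zt (C (F.coeff d) * (X 0 ^ d (Sum.inr 0) * X 1 ^ d (Sum.inr 1)) * g) := by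
        calc _ = (∏ l, E.x l ^ (e l - r l)) * E.y ^ j * E.zt g * ((∏ l, E.x l ^ r l) * E.y) := by
              rw [hx]; ring
          _ = _ := by
            rw [E.rel, aeval_eq_sum, Finset.mul_sum]
            refine Finset.sum_congr rfl fun d _ => ?_
            simp only [pow_add, Finset.prod_mul_distrib, map_mul]
            ring
      rw [this]
      exact sum_mem fun d _ => ih _ _

theorem normalForm_surjective (hr : ∀ l, 0 < r l) : Function.Surjective E.normalForm := by
  rw [← LinearMap.range_eq_top, eq_top_iff, ← Algebra.top_toSubmodule, ← E.adjoin_eq_top,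
    Algebra.adjoin_eq_span, Submodule.span_le]
  intro d hd
  have : ∃ (j : ℕ) (e : Fin m → ℕ) (g : MvPolynomial (Fin 2) k),
      d = (∏ l, E.x l ^ e l) * E.y ^ j * E.zt g := by
    induction hd using Submonoid.closure_induction with
    | mem d hd =>
      rcases hd with ⟨l, rfl⟩ | rfl | rfl | rfl
      · refine ⟨0, Pi.single l 1, 1, ?_⟩
        rw [Finset.prod_eq_single l] <;> simp +contextual
      · exact ⟨1, 0, 1, by simp⟩
      · exact ⟨0, 0, X 0, by simp [zt]⟩
      · exact ⟨0, 0, X 1, by simp [zt]⟩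
    | one => exact ⟨0, 0, 1, by simp⟩
    | mul d d' _ _ hd hd' =>
      obtain ⟨j, e, g, rfl⟩ := hd
      obtain ⟨j', e', g', rfl⟩ := hd'
      refine ⟨j + j', e + e', g * g', ?_⟩
      simp only [pow_add, Finset.prod_mul_distrib, map_mul, Pi.add_apply]
      ring
  obtain ⟨j, e, g, rfl⟩ := this
  exact E.mul_mem_range_normalForm hr j e g

end LaurentPresentation

namespace GoodGenerators
variable {k D : Type} [Field k] [CommRing D] [Algebra k D] {m : ℕ}
    {r : Fin m → ℕ} {F : MvPolynomial (Fin m ⊕ Fin 2) k} {E : LaurentPresentation k D r F}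
    {φ : ExpMap k D} {θ : Fin m → ℝ} {a b wf : ℕ} {μ : ℝ}

theorem lead_normalForm (H : GoodGenerators E φ θ a b wf μ) (hr : ∀ l, 0 < r l)
    (hθ : ∀ (c : Fin m → ℤ) (e : ℤ), ∑ l, (c l : ℝ) * θ l = e → c = 0)
    {g : (Fin m → ℤ) →₀ MvPolynomial (Fin 2) k} (hg : g ≠ 0) :
    ∃ i N γ, γ = monWeight r wf θ (xExp r i) (yExp r i) N ∧
      weightedHomogeneousComponent ![a, b] N (g i) ≠ 0 ∧
      (∀ i', ∀ d ∈ (g i').support,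
        monWeight r wf θ (xExp r i') (yExp r i') (Finsupp.weight ![a, b] d) ≤ γ) ∧
      E.normalForm g ∈ goodLE (lamWeight θ a b) φ E.ι μ γ ∧
      lead (lamWeight θ a b) φ E.ι μ γ (E.normalForm g)
        = (∏ l, lead (lamWeight θ a b) φ E.ι μ (-θ l) (E.x l) ^ xExp r i l)
          * lead (lamWeight θ a b) φ E.ι μ (wf + ∑ l, (r l : ℝ) * θ l) E.y ^ yExp r i
          * aeval ![lead (lamWeight θ a b) φ E.ι μ a E.z, lead (lamWeight θ a b) φ E.ι μ b E.t]
            (weightedHomogeneousComponent ![a, b] N (g i)) := by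
  classical
  have hne : (g.support.sigma fun i => (g i).support).Nonempty := by
    obtain ⟨i, hi⟩ := Finsupp.support_nonempty_iff.mpr hg
    obtain ⟨d, hd⟩ := support_nonempty.mpr (Finsupp.mem_support_iff.mp hi)
    exact ⟨⟨i, d⟩, Finset.mem_sigma.mpr ⟨hi, hd⟩⟩
  obtain ⟨⟨i, d⟩, hid, hmax⟩ := Finset.exists_max_image _ (fun p : Sigma fun _ => _ =>
    monWeight r wf θ (xExp r p.1) (yExp r p.1) (Finsupp.weight ![a, b] p.2)) hne
  rw [Finset.mem_sigma] at hid
  replace hmax : ∀ i', ∀ d' ∈ (g i').support, monWeight r wf θ (xExp r i') (yExp r i')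
      (Finsupp.weight ![a, b] d') ≤ monWeight r wf θ (xExp r i) (yExp r i)
        (Finsupp.weight ![a, b] d) := by
    intro i' d' hd'
    refine hmax ⟨i', d'⟩ (Finset.mem_sigma.mpr ⟨?_, hd'⟩)
    rw [Finsupp.mem_support_iff]
    rintro h
    simp [h] at hd'
  have hsplit : ∀ i N, monWeight r wf θ (xExp r i) (yExp r i) N
      = monWeight r wf θ (xExp r i) (yExp r i) 0 + N := by simp [monWeight]
  set γ := monWeight r wf θ (xExp r i) (yExp r i) (Finsupp.weight ![a, b] d) with hγ
  have hterm : ∀ i', ∀ d' ∈ (g i').support, (Finsupp.weight ![a, b] d' : ℝ)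
      ≤ γ - monWeight r wf θ (xExp r i') (yExp r i') 0 := by
    intro i' d' hd'
    have := hmax i' d' hd'
    rw [hsplit] at this
    linarith
  have hmul := fun i' => H.mul_mem_goodLE (xExp r i') (yExp r i')
    (H.zt_mem_goodLE (hterm i')).1
  simp only [add_sub_cancel] at hmul
  refine ⟨i, Finsupp.weight ![a, b] d, γ, rfl, ?_, hmax, ?_, ?_⟩
  · intro h
    have := congrArg (coeff d) h
    rw [coeff_weightedHomogeneousComponent, if_pos rfl, coeff_zero] at this
    exact mem_support_iff.mp hid.2 this
  · rw [E.normalForm_apply]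
    exact sum_mem fun i' _ => (hmul i').1
  · rw [E.normalForm_apply, map_sum, Finset.sum_eq_single_of_mem i hid.1]
    · rw [(hmul i).2, (H.zt_mem_goodLE (hterm i)).2.2 (Finsupp.weight ![a, b] d)]
      rw [hγ, hsplit i (Finsupp.weight ![a, b] d)]; ring
    · intro i' _ hii'
      rw [(hmul i').2, (H.zt_mem_goodLE (hterm i')).2.1, mul_zero]
      intro d' _ hd'
      refine hii' (eq_of_xExp_eq hr (eq_of_monWeight_eq (wf := wf) hθ
        (N := Finsupp.weight ![a, b] d') (N' := Finsupp.weight ![a, b] d) ?_).1)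
      rw [hsplit i', hd', ← hγ]; ring

end GoodGenerators

/-! ### The slope of an exponential map -/

section Slopes
variable {k G D : Type} [Field k] [AddCommMonoid G] [CommRing D] [Algebra k D]
  (lam : G →+ ℝ) (φ : ExpMap k D) (ι : D →ₐ[k] AddMonoidAlgebra k G)

/-- The slopes of the terms of `φ d` of positive degree, measured from `γ`. -/
def slopes (γ : ℝ) (d : D) : Finset ℝ :=
  open Classical in
  (Finset.Icc 1 (φ.toAlgHom d).natDegree).biUnion fun n =>
    (ι ((φ.toAlgHom d).coeff n)).coeff.support.image fun g => (lam g - γ) / n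

variable {lam φ ι}

theorem mem_slopes {γ : ℝ} {d : D} {ρ : ℝ} : ρ ∈ slopes lam φ ι γ d ↔
    ∃ n : ℕ, 0 < n ∧ ∃ g, (ι ((φ.toAlgHom d).coeff n)).coeff g ≠ 0 ∧ lam g = γ + n * ρ := by
  simp only [slopes, Finset.mem_biUnion, Finset.mem_image, Finset.mem_Icc, Finsupp.mem_support_iff]
  constructor
  · rintro ⟨n, ⟨hn, -⟩, g, hg, rfl⟩
    refine ⟨n, hn, g, hg, ?_⟩
    field_simp
    ring
  · rintro ⟨n, hn, g, hg, h⟩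
    refine ⟨n, ⟨hn, Polynomial.le_natDegree_of_ne_zero fun h0 => hg ?_⟩, g, hg, ?_⟩
    · rw [h0, map_zero]; rfl
    · rw [h]
      field_simp
      ring

theorem mem_goodLE_of_slopes_le {γ μ : ℝ} {d : D} (hd : ι d ∈ weightLE lam γ)
    (h : ∀ ρ ∈ slopes lam φ ι γ d, ρ ≤ μ) : d ∈ goodLE lam φ ι μ γ := by
  intro n g hg
  rcases Nat.eq_zero_or_pos n with rfl | hn
  · rw [coeff_zero_eq] at hg
    simpa using hd g hg
  · have h1 := h ((lam g - γ) / n) (mem_slopes.mpr ⟨n, hn, g, hg, by field_simp; ring⟩)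
    have h2 : (0 : ℝ) < n := Nat.cast_pos.mpr hn
    rw [div_le_iff₀ h2] at h1
    linarith

theorem natDegree_lead_ne_zero {γ μ : ℝ} {d : D} (h : μ ∈ slopes lam φ ι γ d) :
    (lead lam φ ι μ γ d).natDegree ≠ 0 := by
  obtain ⟨n, hn, g, hg, h⟩ := mem_slopes.mp h
  intro h0
  have : (lead lam φ ι μ γ d).coeff n = 0 :=
    Polynomial.coeff_eq_zero_of_natDegree_lt (by omega)
  rw [coeff_lead] at this
  have := congrArg (fun p : AddMonoidAlgebra k G => p.coeff g) this
  simp only [coeff_weightComp, if_pos h] at this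
  exact hg this

theorem eq_C_of_slopes_eq_empty (hι : Function.Injective ι) {γ : ℝ} {d : D}
    (h : slopes lam φ ι γ d = ∅) : φ.toAlgHom d = Polynomial.C d := by
  ext n
  rw [Polynomial.coeff_C]
  split_ifs with hn
  · rw [hn, coeff_zero_eq]
  · by_contra hne
    have : ι ((φ.toAlgHom d).coeff n) ≠ 0 := fun h0 => hne (hι (by rw [h0, map_zero]))
    have hn' : (n : ℝ) ≠ 0 := Nat.cast_ne_zero.mpr hn
    obtain ⟨g, hg⟩ : ∃ g, (ι ((φ.toAlgHom d).coeff n)).coeff g ≠ 0 := by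
      by_contra! hall
      exact this (by ext g; simpa using hall g)
    have hmem := mem_slopes.mpr ⟨n, Nat.pos_of_ne_zero hn, g, hg,
      show lam g = γ + n * ((lam g - γ) / n) by field_simp; ring⟩
    rw [h] at hmem
    exact absurd hmem (Finset.notMem_empty _)

end Slopes

namespace LaurentPresentation
variable {k D : Type} [Field k] [CommRing D] [Algebra k D] {m : ℕ}
  {r : Fin m → ℕ} {F : MvPolynomial (Fin m ⊕ Fin 2) k} (E : LaurentPresentation k D r F)

/-- The generators `x`, `y`, `z`, `t`. -/
def gen : Fin m ⊕ Fin 3 → D := Sum.elim E.x ![E.y, E.z, E.t]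

/-- The weights of the generators. -/
def genWeight (r : Fin m → ℕ) (θ : Fin m → ℝ) (a b wf : ℕ) : Fin m ⊕ Fin 3 → ℝ :=
  Sum.elim (fun l => -θ l) ![wf + ∑ l, (r l : ℝ) * θ l, (a : ℝ), (b : ℝ)]

/-- The slopes of all the generators. -/
def genSlopes (φ : ExpMap k D) (θ : Fin m → ℝ) (a b wf : ℕ) : Finset ℝ :=
  open Classical in Finset.univ.biUnion fun s =>
    slopes (lamWeight θ a b) φ E.ι (genWeight r θ a b wf s) (E.gen s)

variable {E}

theorem goodGenerators {φ : ExpMap k D} {θ : Fin m → ℝ} {a b wf : ℕ} {μ : ℝ}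
    (hF : TermsLE F θ a b wf) (hμ : ∀ ρ ∈ E.genSlopes φ θ a b wf, ρ ≤ μ) :
    GoodGenerators E φ θ a b wf μ := by
  have hs : ∀ s, ∀ ρ ∈ slopes (lamWeight θ a b) φ E.ι (genWeight r θ a b wf s) (E.gen s),
      ρ ≤ μ := fun s ρ hρ => hμ ρ (Finset.mem_biUnion.mpr ⟨s, Finset.mem_univ s, hρ⟩)
  have hx : ∀ l, E.x l ∈ goodLE (lamWeight θ a b) φ E.ι μ (-θ l) := by
    refine fun l => mem_goodLE_of_slopes_le ?_ (hs (Sum.inl l))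
    rw [E.ι_x]
    refine single_mem_weightLE _ (le_of_eq ?_) _
    simp [lamWeight, Pi.single_apply]
  have hz : E.z ∈ goodLE (lamWeight θ a b) φ E.ι μ a := by
    refine mem_goodLE_of_slopes_le ?_ (hs (Sum.inr 1))
    rw [E.ι_z]
    refine single_mem_weightLE _ (le_of_eq ?_) _
    simp [lamWeight, weight_pair]
  have ht : E.t ∈ goodLE (lamWeight θ a b) φ E.ι μ b := by
    refine mem_goodLE_of_slopes_le ?_ (hs (Sum.inr 2))
    rw [E.ι_t]
    refine single_mem_weightLE _ (le_of_eq ?_) _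
    simp [lamWeight, weight_pair]
  refine ⟨hx, mem_goodLE_of_slopes_le ?_ (hs (Sum.inr 0)), hz, ht⟩
  have h1 := (lead_aeval_termsLE hF hx hz ht).1 0
  rw [coeff_zero_eq, ← E.rel, map_mul, map_prod] at h1
  have h2 : (AddMonoidAlgebra.single (-∑ l, (r l) • Pi.single l 1, 0) 1 : Laurent k m)
      ∈ weightLE (lamWeight θ a b) (∑ l, (r l : ℝ) * θ l) := by
    refine single_mem_weightLE _ (le_of_eq ?_) _
    simp [lamWeight, Finset.sum_apply, Pi.single_apply]
  have h3 := mul_mem_weightLE _ h2 h1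
  have h4 : ∏ l, E.ι (E.x l ^ r l)
      = AddMonoidAlgebra.single (∑ l, (r l) • Pi.single l 1, 0) 1 := by
    have : ∀ s : Finset (Fin m), ∏ l ∈ s, E.ι (E.x l ^ r l)
        = AddMonoidAlgebra.single (∑ l ∈ s, (r l) • Pi.single l 1, 0) 1 := by
      intro s
      induction s using Finset.induction_on with
      | empty => simp; rfl
      | insert l s hl ih =>
        rw [Finset.prod_insert hl, ih, Finset.sum_insert hl, map_pow, E.ι_x,
          AddMonoidAlgebra.single_pow, AddMonoidAlgebra.single_mul_single]
        simp
    exact this Finset.univ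
  rw [h4, ← mul_assoc, AddMonoidAlgebra.single_mul_single] at h3
  have h5 : (AddMonoidAlgebra.single ((-∑ l, (r l) • Pi.single l 1, 0)
      + (∑ l, (r l) • Pi.single l 1, 0)) (1 * 1) : Laurent k m) = 1 := by
    simp only [AddMonoidAlgebra.one_def, Prod.mk_add_mk, neg_add_cancel, add_zero, mul_one]
    rfl
  rw [h5, one_mul] at h3
  convert h3 using 2
  simp; ring

end LaurentPresentation

instance (k : Type) [Field k] (m : ℕ) : IsDomain (Laurent k m) := NoZeroDivisors.to_isDomain _

namespace GoodGenerators
variable {k D : Type} [Field k] [CommRing D] [Algebra k D] {m : ℕ}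
    {r : Fin m → ℕ} {F : MvPolynomial (Fin m ⊕ Fin 2) k} {E : LaurentPresentation k D r F}
    {φ : ExpMap k D} {θ : Fin m → ℝ} {a b wf : ℕ} {μ : ℝ}

theorem coeff_zero_lead_x (l : Fin m) :
    (lead (lamWeight θ a b) φ E.ι μ (-θ l) (E.x l)).coeff 0 ≠ 0 := by
  have : lamWeight θ a b (Pi.single l 1, 0) = -θ l := by
    simp [lamWeight, Pi.single_apply]
  rw [coeff_zero_lead, E.ι_x, weightComp_single, if_pos this]
  simp

theorem coeff_zero_aeval_lead (g : MvPolynomial (Fin 2) k) :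
    (aeval ![lead (lamWeight θ a b) φ E.ι μ a E.z, lead (lamWeight θ a b) φ E.ι μ b E.t] g).coeff 0
      = E.ι (E.zt g) := by
  have : (Polynomial.constantCoeff.comp (aeval ![lead (lamWeight θ a b) φ E.ι μ a E.z,
      lead (lamWeight θ a b) φ E.ι μ b E.t]).toRingHom)
      = (E.ι.comp E.zt).toRingHom := by
    refine MvPolynomial.ringHom_ext (fun c => ?_) fun s => ?_
    · simp
    · fin_cases s
      · have : lamWeight θ a b ((0 : Fin m → ℤ), Finsupp.single 0 1) = a := by
          simp [lamWeight, weight_pair]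
        simp [coeff_zero_lead, LaurentPresentation.zt, E.ι_z, weightComp_single, this]
      · have : lamWeight θ a b ((0 : Fin m → ℤ), Finsupp.single 1 1) = b := by
          simp [lamWeight, weight_pair]
        simp [coeff_zero_lead, LaurentPresentation.zt, E.ι_t, weightComp_single, this]
  exact RingHom.congr_fun this g

theorem coeff_zero_aeval_lead_ne_zero {g : MvPolynomial (Fin 2) k} (hg : g ≠ 0) :
    (aeval ![lead (lamWeight θ a b) φ E.ι μ a E.z, lead (lamWeight θ a b) φ E.ι μ b E.t] g).coeff 0
      ≠ 0 := by
  rw [coeff_zero_aeval_lead]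
  exact fun h => hg (E.ι_zt_injective (by simp [h]))

theorem coeff_zero_lead_y (H : GoodGenerators E φ θ a b wf μ) (hF : TermsLE F θ a b wf)
    (hf : weightedHomogeneousComponent ![a, b] wf (fOf k m F) ≠ 0) :
    (lead (lamWeight θ a b) φ E.ι μ (wf + ∑ l, (r l : ℝ) * θ l) E.y).coeff 0 ≠ 0 := by
  intro h
  have h1 := congrArg (fun p => p.coeff 0) (H.lead_rel hF)
  simp only [Polynomial.mul_coeff_zero, h, mul_zero] at h1
  exact coeff_zero_aeval_lead_ne_zero hf h1.symm

theorem coeff_zero_lead_normalForm (H : GoodGenerators E φ θ a b wf μ) (hr : ∀ l, 0 < r l)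
    (hθ : ∀ (c : Fin m → ℤ) (e : ℤ), ∑ l, (c l : ℝ) * θ l = e → c = 0)
    (hF : TermsLE F θ a b wf) (hf : weightedHomogeneousComponent ![a, b] wf (fOf k m F) ≠ 0)
    {g : (Fin m → ℤ) →₀ MvPolynomial (Fin 2) k} (hg : g ≠ 0) :
    ∃ i N γ, γ = monWeight r wf θ (xExp r i) (yExp r i) N ∧
      (∃ d ∈ (g i).support, Finsupp.weight ![a, b] d = N) ∧
      (∀ i', ∀ d ∈ (g i').support,
        monWeight r wf θ (xExp r i') (yExp r i') (Finsupp.weight ![a, b] d) ≤ γ) ∧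
      E.normalForm g ∈ goodLE (lamWeight θ a b) φ E.ι μ γ ∧
      lead (lamWeight θ a b) φ E.ι μ γ (E.normalForm g)
        = (∏ l, lead (lamWeight θ a b) φ E.ι μ (-θ l) (E.x l) ^ xExp r i l)
          * lead (lamWeight θ a b) φ E.ι μ (wf + ∑ l, (r l : ℝ) * θ l) E.y ^ yExp r i
          * aeval ![lead (lamWeight θ a b) φ E.ι μ a E.z, lead (lamWeight θ a b) φ E.ι μ b E.t]
            (weightedHomogeneousComponent ![a, b] N (g i)) ∧
      (lead (lamWeight θ a b) φ E.ι μ γ (E.normalForm g)).coeff 0 ≠ 0 := by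
  obtain ⟨i, N, γ, h1, h2, h3, h4, h5⟩ := H.lead_normalForm hr hθ hg
  refine ⟨i, N, γ, h1, ?_, h3, h4, h5, ?_⟩
  · by_contra! hall
    exact h2 (weightedHomogeneousComponent_eq_zero' _ _ hall)
  rw [h5, Polynomial.mul_coeff_zero, Polynomial.mul_coeff_zero]
  refine mul_ne_zero (mul_ne_zero ?_ ?_) (coeff_zero_aeval_lead_ne_zero h2)
  · rw [Polynomial.coeff_zero_prod]
    exact Finset.prod_ne_zero_iff.mpr fun l _ => by
      rw [← Polynomial.constantCoeff_apply, map_pow]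
      exact pow_ne_zero _ (coeff_zero_lead_x l)
  · rw [← Polynomial.constantCoeff_apply, map_pow]
    exact pow_ne_zero _ (H.coeff_zero_lead_y hF hf)

theorem ι_injective (H : GoodGenerators E φ θ a b wf μ) (hr : ∀ l, 0 < r l)
    (hθ : ∀ (c : Fin m → ℤ) (e : ℤ), ∑ l, (c l : ℝ) * θ l = e → c = 0)
    (hF : TermsLE F θ a b wf) (hf : weightedHomogeneousComponent ![a, b] wf (fOf k m F) ≠ 0) :
    Function.Injective E.ι := by
  rw [injective_iff_map_eq_zero]
  intro d hd
  obtain ⟨g, rfl⟩ := E.normalForm_surjective hr d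
  by_contra hne
  obtain ⟨i, N, γ, -, -, -, -, -, h⟩ := H.coeff_zero_lead_normalForm hr hθ hF hf
    (g := g) (by rintro rfl; exact hne (map_zero _))
  rw [coeff_zero_lead, hd, map_zero] at h
  exact h rfl

/-- The leading parts form a graded exponential system. -/
def gradedExp (H : GoodGenerators E φ θ a b wf μ) (hr : ∀ l, 0 < r l)
    (hθ : ∀ (c : Fin m → ℤ) (e : ℤ), ∑ l, (c l : ℝ) * θ l = e → c = 0)
    (hF : TermsLE F θ a b wf) (hf : weightedHomogeneousComponent ![a, b] wf (fOf k m F) ≠ 0)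
    (hμ : μ ∈ E.genSlopes φ θ a b wf)
    (hy : (lead (lamWeight θ a b) φ E.ι μ (wf + ∑ l, (r l : ℝ) * θ l) E.y).natDegree = 0) :
    GradedExp k (Laurent k m) r a b wf θ (weightedHomogeneousComponent ![a, b] wf (fOf k m F)) where
  shift := μ
  piece γ := (goodLE (lamWeight θ a b) φ E.ι μ γ).map (lead (lamWeight θ a b) φ E.ι μ γ)
  xs l := lead (lamWeight θ a b) φ E.ι μ (-θ l) (E.x l)
  y := lead (lamWeight θ a b) φ E.ι μ (wf + ∑ l, (r l : ℝ) * θ l) E.y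
  ev := aeval ![lead (lamWeight θ a b) φ E.ι μ a E.z, lead (lamWeight θ a b) φ E.ι μ b E.t]
  ev_injective := by
    rw [injective_iff_map_eq_zero]
    intro g hg
    by_contra hne
    exact coeff_zero_aeval_lead_ne_zero hne (by rw [hg, Polynomial.coeff_zero])
  one_mem := by
    refine ⟨algebraMap k D 1, algebraMap_mem_goodLE _ _ _ 1, ?_⟩
    rw [lead_algebraMap, map_one]
  mul_mem := by
    rintro γ γ' _ _ ⟨d, hd, rfl⟩ ⟨d', hd', rfl⟩
    exact ⟨d * d', _root_.mul_mem_goodLE _ _ _ hd hd', lead_mul _ _ _ hd hd'⟩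
  hasse := by
    rintro γ _ ⟨d, hd, rfl⟩ n
    exact ⟨_, ⟨_, coeff_mem_goodLE _ _ _ hd n, rfl⟩, coeff_lead_coeff _ _ _ γ d n⟩
  normal := by
    rintro γ _ ⟨d, hd, rfl⟩ hne
    obtain ⟨g, rfl⟩ := E.normalForm_surjective hr d
    obtain ⟨i, N, γ', h1, -, -, h2, h3, h4⟩ := H.coeff_zero_lead_normalForm hr hθ hF hf
      (g := g) (by rintro rfl; exact hne (by rw [map_zero, map_zero]))
    have e : γ = γ' := by
      refine le_antisymm ?_ ?_
      · by_contra! hlt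
        exact hne (lead_eq_zero _ _ _ h2 hlt)
      · by_contra! hlt
        exact h4 (by rw [lead_eq_zero _ _ _ hd hlt, Polynomial.coeff_zero])
    exact ⟨_, _, N, _, weightedHomogeneousComponent_isWeightedHomogeneous _ _, e.trans h1,
      by rw [e, h3]⟩
  xs_mem l := ⟨_, H.x_mem l, rfl⟩
  ev_mem := by
    intro N g hg
    have h := H.zt_mem_goodLE (g := g) (ν := N) fun d hd => by
      rw [hg (mem_support_iff.mp hd)]
    exact ⟨_, h.1, by rw [h.2.2 N rfl, hg.weightedHomogeneousComponent_same]⟩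
  rel := H.lead_rel hF
  natDegree_y := hy
  nontriv := by
    obtain ⟨s, -, hs⟩ := Finset.mem_biUnion.mp hμ
    refine ⟨_, _, ⟨E.gen s, ?_, rfl⟩, natDegree_lead_ne_zero hs⟩
    rcases s with l | s
    · exact H.x_mem l
    · fin_cases s
      · exact H.y_mem
      · exact H.z_mem
      · exact H.t_mem

end GoodGenerators

namespace LaurentPresentation
variable {k D : Type} [Field k] [CommRing D] [Algebra k D] {m : ℕ}
  {r : Fin m → ℕ} {F : MvPolynomial (Fin m ⊕ Fin 2) k} {E : LaurentPresentation k D r F}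

/-- There is no exponential map with an invariant of negative degree in `x`, for suitable
weights. -/
theorem false_of_weights (hr : ∀ l, 1 < r l) {φ : ExpMap k D} (hφ : φ.invariants ≠ ⊤)
    {θ : Fin m → ℝ} {a b wf : ℕ}
    (hθ : ∀ (c : Fin m → ℤ) (e : ℤ), ∑ l, (c l : ℝ) * θ l = e → c = 0)
    (hF : TermsLE F θ a b wf) (hf : weightedHomogeneousComponent ![a, b] wf (fOf k m F) ≠ 0)
    {g : (Fin m → ℤ) →₀ MvPolynomial (Fin 2) k} (hg : E.normalForm g ∈ φ.invariants)
    (hgy : ∃ i, ∃ d ∈ (g i).support, ∀ i', ∀ d' ∈ (g i').support, yExp r i' = 0 →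
      monWeight r wf θ (xExp r i') (yExp r i') (Finsupp.weight ![a, b] d')
        < monWeight r wf θ (xExp r i) (yExp r i) (Finsupp.weight ![a, b] d))
    (ha : 2 ≤ a) (hb : 2 ≤ b) (hab : a.Coprime b) {α β : k} (hα : α ≠ 0) (hβ : β ≠ 0)
    (hz : aeval ![α, β] (weightedHomogeneousComponent ![a, b] wf (fOf k m F)) = 0) : False := by
  have hr0 : ∀ l, 0 < r l := fun l => (hr l).le
  have hinj : Function.Injective E.ι := by
    obtain ⟨μ, hμ⟩ := (E.genSlopes φ θ a b wf).exists_le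
    exact (goodGenerators hF hμ).ι_injective hr0 hθ hF hf
  have hne : (E.genSlopes φ θ a b wf).Nonempty := by
    rw [Finset.nonempty_iff_ne_empty]
    intro h
    refine hφ (top_le_iff.mp ?_)
    rw [← E.adjoin_eq_top, Algebra.adjoin_le_iff]
    have hs : ∀ s, E.gen s ∈ φ.invariants := by
      intro s
      refine eq_C_of_slopes_eq_empty (lam := lamWeight θ a b) hinj (γ := genWeight r θ a b wf s)
        (Finset.eq_empty_of_forall_notMem fun ρ hρ => ?_)
      exact absurd (Finset.mem_biUnion.mpr ⟨s, Finset.mem_univ s, hρ⟩)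
        (h ▸ Finset.notMem_empty ρ)
    rintro d (⟨l, rfl⟩ | rfl | rfl | rfl)
    · exact hs (Sum.inl l)
    · exact hs (Sum.inr 0)
    · exact hs (Sum.inr 1)
    · exact hs (Sum.inr 2)
  have hmax := Finset.max'_mem _ hne
  have hle : ∀ ρ ∈ E.genSlopes φ θ a b wf, ρ ≤ (E.genSlopes φ θ a b wf).max' hne :=
    fun ρ hρ => Finset.le_max' _ ρ hρ
  set μ := (E.genSlopes φ θ a b wf).max' hne
  have H := goodGenerators hF hle
  obtain ⟨i₁, d₁, hd₁, hlt⟩ := hgy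
  obtain ⟨i, N, γ, h1, ⟨d, hd, hdN⟩, h2, -, h4, h5⟩ := H.coeff_zero_lead_normalForm hr0 hθ hF hf
    (g := g) (by rintro rfl; simp at hd₁)
  have hy : (lead (lamWeight θ a b) φ E.ι μ (wf + ∑ l, (r l : ℝ) * θ l) E.y).natDegree = 0 := by
    refine natDegree_eq_zero_of_dvd_of_natDegree_eq_zero
      (q := lead (lamWeight θ a b) φ E.ι μ γ (E.normalForm g)) ?_ (fun h => h5 (by simp [h])) ?_
    · have hi : yExp r i ≠ 0 := by
        intro hi
        have h6 := hlt i d hd hi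
        rw [hdN, ← h1] at h6
        exact absurd (h2 i₁ d₁ hd₁) (not_le.mpr h6)
      rw [h4]
      exact ((dvd_pow_self _ hi).mul_left _).mul_right _
    · refine Polynomial.natDegree_eq_zero_iff_degree_le_zero.mpr ?_
      rw [Polynomial.degree_le_zero_iff]
      ext n
      rw [Polynomial.coeff_C]
      split_ifs with hn
      · rw [hn]
      · rw [coeff_lead, show φ.toAlgHom (E.normalForm g) = _ from hg, Polynomial.coeff_C, if_neg hn,
          map_zero, map_zero]
  exact (H.gradedExp hr0 hθ hF hf hmax hy).not_exists hf hr ha hb hab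
    (weightedHomogeneousComponent_isWeightedHomogeneous _ _) hθ hα hβ hz

end LaurentPresentation

/-! ### Choice of weights -/

section ChoiceOfWeights

theorem exists_transcendental_gt (W : ℝ) : ∃ τ, W < τ ∧ Transcendental ℤ τ := by
  have h := (Algebraic.countable ℤ ℝ).dense_compl ℝ
  obtain ⟨τ, hτ, hW⟩ := h.exists_gt W
  exact ⟨τ, hW, hτ⟩

theorem eq_zero_of_sum_pow_eq {m : ℕ} {τ : ℝ} (hτ : Transcendental ℤ τ) {c : Fin m → ℤ} {e : ℤ}
    (h : ∑ l, (c l : ℝ) * τ ^ (l.val + 1) = e) : c = 0 := by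
  have h0 := transcendental_iff.mp hτ
    (∑ l, Polynomial.monomial (l.val + 1) (c l) - Polynomial.C e) (by
      simp [Polynomial.aeval_monomial, h])
  funext l
  have h1 := congrArg (fun p => p.coeff (l.val + 1)) h0
  simp only [Polynomial.coeff_sub, Polynomial.finsetSum_coeff, Polynomial.coeff_monomial,
    Polynomial.coeff_C_succ, sub_zero, Polynomial.coeff_zero, add_left_inj, Fin.val_inj] at h1
  simpa using h1

theorem exists_independent_weights {m : ℕ} (W : ℝ) (i : Fin m → ℤ) {l₀ : Fin m} (hi : i l₀ < 0) :
    ∃ θ : Fin m → ℝ, (∀ (c : Fin m → ℤ) (e : ℤ), ∑ l, (c l : ℝ) * θ l = e → c = 0) ∧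
      (∀ l, W < θ l) ∧ W < -∑ l, (i l : ℝ) * θ l := by
  obtain ⟨τ, hτW, hτ⟩ := exists_transcendental_gt (max W 1)
  have hτ1 : 1 < τ := (le_max_right _ _).trans_lt hτW
  have hpow : ∀ l : ℕ, τ ≤ τ ^ (l + 1) := fun l => le_self_pow₀ hτ1.le (Nat.succ_ne_zero l)
  have hpos : ∀ l : ℕ, 0 < τ ^ (l + 1) := fun l => by positivity
  obtain ⟨Q, hQ⟩ := exists_nat_gt
    (W + ∑ l ∈ Finset.univ.erase l₀, (i l : ℝ) * τ ^ (l.val + 1))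
  refine ⟨fun l => (if l = l₀ then ((Q + 1 : ℕ) : ℝ) else 1) * τ ^ (l.val + 1), ?_, ?_, ?_⟩
  · intro c e h
    have h1 := eq_zero_of_sum_pow_eq hτ
      (c := fun l => c l * (if l = l₀ then ((Q + 1 : ℕ) : ℤ) else 1)) (e := e) (by
        rw [← h]
        refine Finset.sum_congr rfl fun l _ => ?_
        beta_reduce
        split_ifs <;> push_cast <;> ring)
    funext l
    have h2 := congrFun h1 l
    simp only [Pi.zero_apply, mul_eq_zero] at h2
    refine h2.resolve_right ?_
    split_ifs <;> omega
  · intro l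
    have h1 : W < τ ^ (l.val + 1) := (le_max_left _ _).trans_lt (hτW.trans_le (hpow l))
    refine h1.trans_le (le_mul_of_one_le_left (hpos l).le ?_)
    split_ifs
    · push_cast
      linarith [Nat.cast_nonneg (α := ℝ) Q]
    · rfl
  · rw [← Finset.add_sum_erase _ _ (Finset.mem_univ l₀)]
    beta_reduce
    rw [if_pos rfl]
    have h1 : ∑ l ∈ Finset.univ.erase l₀, (i l : ℝ) *
        ((if l = l₀ then ((Q + 1 : ℕ) : ℝ) else 1) * τ ^ (l.val + 1))
        = ∑ l ∈ Finset.univ.erase l₀, (i l : ℝ) * τ ^ (l.val + 1) :=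
      Finset.sum_congr rfl fun l hl => by rw [if_neg (Finset.ne_of_mem_erase hl), one_mul]
    rw [h1]
    have h2 : (1 : ℝ) ≤ -(i l₀ : ℝ) := by
      have : (1 : ℤ) ≤ -i l₀ := by omega
      exact_mod_cast this
    have h3 : (1 : ℝ) ≤ τ ^ (l₀.val + 1) := hτ1.le.trans (hpow _)
    have h4 : (Q : ℝ) + 1 ≤ ((Q : ℝ) + 1) * τ ^ (l₀.val + 1) :=
      le_mul_of_one_le_right (by positivity) h3
    have h5 : ((Q : ℝ) + 1) * τ ^ (l₀.val + 1)
        ≤ -(i l₀ : ℝ) * (((Q : ℝ) + 1) * τ ^ (l₀.val + 1)) :=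
      le_mul_of_one_le_left (by positivity) h2
    push_cast
    linarith

variable {k : Type} [Field k] {m : ℕ}

theorem coeff_fOf (F : MvPolynomial (Fin m ⊕ Fin 2) k) {d : Fin m ⊕ Fin 2 →₀ ℕ} {e : Fin 2 →₀ ℕ}
    (hd : ∀ l, d (Sum.inl l) = 0) (he : ∀ s, e s = d (Sum.inr s)) :
    (fOf k m F).coeff e = F.coeff d := by
  have h : fOf k m F = ∑ d ∈ F.support, fOf k m (monomial d (F.coeff d)) := by
    simp only [fOf]
    rw [← map_sum, ← F.as_sum]
  rw [h, coeff_sum, Finset.sum_eq_single d]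
  · rcases fOf_monomial d (F.coeff d) with ⟨-, l, hl⟩ | ⟨-, e', h1, h2⟩
    · exact absurd (hd l) hl
    · rw [h1, show e' = e from Finsupp.ext fun s => by rw [h2, he], coeff_monomial, if_pos rfl]
  · intro d' _ hne
    rcases fOf_monomial d' (F.coeff d') with ⟨h1, -⟩ | ⟨h0, e', h1, h2⟩
    · rw [h1, coeff_zero]
    · rw [h1, coeff_monomial, if_neg]
      rintro rfl
      refine hne (Finsupp.ext fun s => ?_)
      rcases s with l | s
      · rw [h0, hd]
      · rw [← h2, ← he]
  · intro hd'
    rw [notMem_support_iff.mp hd', map_zero, fOf, map_zero, coeff_zero]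

theorem exists_weights {r : Fin m → ℕ} (hr : ∀ l, 0 < r l) (F : MvPolynomial (Fin m ⊕ Fin 2) k)
    {a b wf : ℕ} (hwf : ∀ d ∈ (fOf k m F).support, Finsupp.weight ![a, b] d ≤ wf)
    {g : (Fin m → ℤ) →₀ MvPolynomial (Fin 2) k} (hg : ∃ i ∈ g.support, ∃ l, i l < 0) :
    ∃ θ : Fin m → ℝ, (∀ (c : Fin m → ℤ) (e : ℤ), ∑ l, (c l : ℝ) * θ l = e → c = 0) ∧
      TermsLE F θ a b wf ∧
      ∃ i, ∃ d ∈ (g i).support, ∀ i', ∀ d' ∈ (g i').support, yExp r i' = 0 →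
      monWeight r wf θ (xExp r i') (yExp r i') (Finsupp.weight ![a, b] d')
        < monWeight r wf θ (xExp r i) (yExp r i) (Finsupp.weight ![a, b] d) := by
  classical
  obtain ⟨i, hi, l₀, hl₀⟩ := hg
  set W₁ : ℕ := F.support.sup fun d => d (Sum.inr 0) * a + d (Sum.inr 1) * b with hW₁
  set W₂ : ℕ := g.support.sup fun i => (g i).support.sup fun d => Finsupp.weight ![a, b] d with hW₂
  obtain ⟨θ, h1, h2, h3⟩ := exists_independent_weights ((W₁ : ℝ) + W₂) i hl₀
  have hθ0 : ∀ l, 0 ≤ θ l := fun l => le_trans (by positivity) (h2 l).le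
  refine ⟨θ, h1, ?_, i, ?_⟩
  · intro d hd
    have hlt : (∃ l, d (Sum.inl l) ≠ 0) → ∑ s, d s * varWeight θ a b s < wf := by
      rintro ⟨l, hl⟩
      rw [sum_varWeight]
      have h4 : d (Sum.inr 0) * a + d (Sum.inr 1) * b ≤ W₁ :=
        Finset.le_sup (f := fun d : Fin m ⊕ Fin 2 →₀ ℕ =>
          d (Sum.inr 0) * a + d (Sum.inr 1) * b) hd
      have h4' : ((d (Sum.inr 0) * a + d (Sum.inr 1) * b : ℕ) : ℝ) ≤ W₁ := by exact_mod_cast h4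
      have h5 : (d (Sum.inl l) : ℝ) * θ l ≤ ∑ l, (d (Sum.inl l) : ℝ) * θ l :=
        Finset.single_le_sum (f := fun l => (d (Sum.inl l) : ℝ) * θ l)
          (fun l _ => mul_nonneg (Nat.cast_nonneg _) (hθ0 l)) (Finset.mem_univ l)
      have h6 : θ l ≤ (d (Sum.inl l) : ℝ) * θ l :=
        le_mul_of_one_le_left (hθ0 l) (Nat.one_le_cast.mpr (Nat.one_le_iff_ne_zero.mpr hl))
      have h7 := h2 l
      have h8 : (0 : ℝ) ≤ W₂ := Nat.cast_nonneg _
      have h9 : (0 : ℝ) ≤ wf := Nat.cast_nonneg _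
      linarith
    refine ⟨?_, hlt⟩
    by_cases hx : ∃ l, d (Sum.inl l) ≠ 0
    · exact (hlt hx).le
    · push Not at hx
      rw [sum_varWeight]
      simp only [hx, Nat.cast_zero, zero_mul, Finset.sum_const_zero, neg_zero, zero_add,
        Nat.cast_le]
      have h4 := coeff_fOf F (e := Finsupp.equivFunOnFinite.symm fun s => d (Sum.inr s)) hx
        fun s => rfl
      have h5 := hwf _ (mem_support_iff.mpr (h4 ▸ mem_support_iff.mp hd))
      rwa [weight_pair] at h5
  · obtain ⟨d, hd⟩ := support_nonempty.mpr (Finsupp.mem_support_iff.mp hi)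
    refine ⟨d, hd, fun i' d' hd' hy => ?_⟩
    have hi' : i' ∈ g.support := by
      rw [Finsupp.mem_support_iff]
      rintro h
      simp [h] at hd'
    have h4 : Finsupp.weight ![a, b] d' ≤ W₂ :=
      (Finset.le_sup (f := fun d => Finsupp.weight ![a, b] d) hd').trans
        (Finset.le_sup (f := fun i => (g i).support.sup fun d => Finsupp.weight ![a, b] d) hi')
    have h4' : ((Finsupp.weight ![a, b] d' : ℕ) : ℝ) ≤ W₂ := by exact_mod_cast h4
    have h5 : 0 ≤ ∑ l, (xExp r i' l : ℝ) * θ l :=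
      Finset.sum_nonneg fun l _ => mul_nonneg (Nat.cast_nonneg _) (hθ0 l)
    have h6 : monWeight r wf θ (xExp r i) (yExp r i) (Finsupp.weight ![a, b] d)
        = -∑ l, (i l : ℝ) * θ l + yExp r i * wf + (Finsupp.weight ![a, b] d : ℕ) := by
      have : ∀ l, (xExp r i l : ℝ) = i l + yExp r i * r l := fun l => by
        exact_mod_cast congrArg (Int.cast (R := ℝ)) (cast_xExp hr i l)
      simp only [monWeight, this, add_mul, Finset.sum_add_distrib, mul_add, Finset.mul_sum,
        mul_assoc]
      ring
    rw [h6, monWeight, hy]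
    have h7 : (0 : ℝ) ≤ W₁ := Nat.cast_nonneg _
    have h8 : (0 : ℝ) ≤ yExp r i * wf := by positivity
    have h9 : (0 : ℝ) ≤ (Finsupp.weight ![a, b] d : ℕ) := Nat.cast_nonneg _
    push_cast
    linarith

end ChoiceOfWeights

namespace LaurentPresentation
variable {k D : Type} [Field k] [CommRing D] [Algebra k D] {m : ℕ}
  {r : Fin m → ℕ} {F : MvPolynomial (Fin m ⊕ Fin 2) k} (E : LaurentPresentation k D r F)

/-- If some invariant is not a polynomial in `x`, `z`, `t`, then the leading weighted part of
`F 0 z t` does not vanish at points with nonzero coordinates. -/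
theorem aeval_weightedHomogeneousComponent_ne_zero (hr : ∀ l, 1 < r l) {φ : ExpMap k D}
    (hφ : φ.invariants ≠ ⊤) {d : D} (hd : d ∈ φ.invariants)
    (hdB : d ∉ Algebra.adjoin k (Set.range E.x ∪ {E.z, E.t})) {a b wf : ℕ}
    (hwf : ∀ d ∈ (fOf k m F).support, Finsupp.weight ![a, b] d ≤ wf)
    (hf : weightedHomogeneousComponent ![a, b] wf (fOf k m F) ≠ 0)
    (ha : 2 ≤ a) (hb : 2 ≤ b) (hab : a.Coprime b) {α β : k} (hα : α ≠ 0) (hβ : β ≠ 0) :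
    aeval ![α, β] (weightedHomogeneousComponent ![a, b] wf (fOf k m F)) ≠ 0 := by
  intro hz
  have hr0 : ∀ l, 0 < r l := fun l => (hr l).le
  obtain ⟨g, rfl⟩ := E.normalForm_surjective hr0 d
  have hg : ∃ i ∈ g.support, ∃ l, i l < 0 := by
    by_contra! hall
    refine hdB ?_
    rw [E.normalForm_apply]
    refine sum_mem fun i hi => ?_
    rw [yExp_eq_zero (hall i hi), pow_zero, mul_one]
    have hx : ∀ l, E.x l ∈ Algebra.adjoin k (Set.range E.x ∪ {E.z, E.t}) := fun l =>
      Algebra.subset_adjoin (Set.mem_union_left _ ⟨l, rfl⟩)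
    refine mul_mem (prod_mem fun l _ => pow_mem (hx l) _) ?_
    have h1 : E.zt (g i) ∈ Algebra.adjoin k (Set.range ![E.z, E.t]) := by
      rw [Algebra.adjoin_range_eq_range_aeval]
      exact ⟨g i, rfl⟩
    refine Algebra.adjoin_mono ?_ h1
    rintro _ ⟨s, rfl⟩
    fin_cases s <;> simp
  obtain ⟨θ, h1, h2, h3⟩ := exists_weights hr0 F hwf hg
  exact false_of_weights hr hφ h1 h2 hf hd h3 ha hb hab hα hβ hz

end LaurentPresentation

/-! ### Presentations of the ring `A` -/

section Presentation
variable {k : Type} [Field k] {m : ℕ} (r : Fin m → ℕ) (F : MvPolynomial (Fin m ⊕ Fin 2) k)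
  (σ : MvPolynomial (Fin 2) k ≃ₐ[k] MvPolynomial (Fin 2) k)

theorem aeval_pair_algEquiv {S : Type} [CommRing S] [Algebra k S] (u v : S)
    (p : MvPolynomial (Fin 2) k) :
    aeval ![aeval ![u, v] (σ (X 0)), aeval ![u, v] (σ (X 1))] p = aeval ![u, v] (σ p) := by
  have h : aeval ![aeval ![u, v] (σ (X 0)), aeval ![u, v] (σ (X 1))]
      = (aeval (R := k) ![u, v]).comp σ.toAlgHom := by
    ext s
    fin_cases s <;> simp
  exact DFunLike.congr_fun h p

/-- The polynomial `F` with the inverse of `σ` applied to the last two variables. -/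
def changeVars : MvPolynomial (Fin m ⊕ Fin 2) k :=
  aeval (Sum.elim (fun l => X (Sum.inl l)) fun s => rename Sum.inr (σ.symm (X s))) F

theorem aeval_changeVars {S : Type} [CommRing S] [Algebra k S] (x : Fin m → S) (u v : S) :
    aeval (Sum.elim x ![aeval ![u, v] (σ (X 0)), aeval ![u, v] (σ (X 1))]) (changeVars F σ)
      = aeval (Sum.elim x ![u, v]) F := by
  have h : (aeval (Sum.elim x ![aeval ![u, v] (σ (X 0)), aeval ![u, v] (σ (X 1))])).comp
      (aeval (R := k) (Sum.elim (fun l => X (Sum.inl l)) fun s => rename Sum.inr (σ.symm (X s))))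
      = aeval (R := k) (Sum.elim x ![u, v]) := by
    ext s
    rcases s with l | s
    · simp
    · simp only [AlgHom.comp_apply, aeval_X, Sum.elim_inr, aeval_rename, Sum.elim_comp_inr]
      rw [aeval_pair_algEquiv, AlgEquiv.apply_symm_apply, aeval_X]
  exact DFunLike.congr_fun h F

theorem fOf_changeVars : fOf k m (changeVars F σ) = σ.symm (fOf k m F) := by
  have h : (aeval (Sum.elim (fun _ => (0 : MvPolynomial (Fin 2) k)) X)).comp
      (aeval (R := k) (Sum.elim (fun l : Fin m => X (Sum.inl l))
        fun s => rename Sum.inr (σ.symm (X s))))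
      = σ.symm.toAlgHom.comp (aeval (Sum.elim (fun _ => 0) X)) := by
    ext1 s
    rcases s with l | s
    · simp
    · simp only [AlgHom.comp_apply, aeval_X, Sum.elim_inr, aeval_rename, Sum.elim_comp_inr]
      exact DFunLike.congr_fun aeval_X_left _
  exact DFunLike.congr_fun h F

theorem aeval_BigP {S : Type} [CommRing S] [Algebra k S] (x : Fin m → S) (y u v : S)
    (p : MvPolynomial (Fin m ⊕ Fin 2) k) :
    aeval (Sum.elim x ![y, u, v]) (incl k m p) = aeval (Sum.elim x ![u, v]) p := by
  rw [incl, aeval_rename]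
  congr 2
  funext s
  rcases s with l | s
  · rfl
  · fin_cases s <;> rfl

theorem mk_eq_aeval (p : BigP k m) :
    (Ideal.Quotient.mk (Ideal.span {relG k m r F}) p : RingA k m r F)
      = aeval (Sum.elim (xA k m r F) ![yA k m r F, zA k m r F, tA k m r F]) p := by
  have h : Ideal.Quotient.mkₐ k (Ideal.span {relG k m r F})
      = aeval (Sum.elim (xA k m r F) ![yA k m r F, zA k m r F, tA k m r F]) := by
    ext s
    rcases s with l | s
    · simp [xA]
    · fin_cases s <;> simp [yA, zA, tA]
  exact DFunLike.congr_fun h p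

theorem aeval_relG {S : Type} [CommRing S] [Algebra k S] (x : Fin m → S) (y u v : S) :
    aeval (Sum.elim x ![y, u, v]) (relG k m r F)
      = (∏ l, x l ^ r l) * y - aeval (Sum.elim x ![u, v]) F := by
  simp [relG, aeval_BigP]

theorem relA : (∏ l, xA k m r F l ^ r l) * yA k m r F
    = aeval (Sum.elim (xA k m r F) ![zA k m r F, tA k m r F]) F := by
  have h := mk_eq_aeval r F (relG k m r F)
  rw [Ideal.Quotient.eq_zero_iff_mem.mpr (Ideal.mem_span_singleton_self _), aeval_relG] at h
  exact sub_eq_zero.mp h.symm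

theorem adjoin_pair_eq {S : Type} [CommRing S] [Algebra k S] (u v : S) :
    Algebra.adjoin k {aeval ![u, v] (σ (X 0)), aeval ![u, v] (σ (X 1))}
      = Algebra.adjoin k {u, v} := by
  have h : ∀ u v : S, Algebra.adjoin k {u, v} = (aeval (R := k) ![u, v]).range := by
    intro u v
    rw [← Algebra.adjoin_range_eq_range_aeval, Matrix.range_cons, Matrix.range_cons,
      Matrix.range_empty, Set.union_empty, Set.singleton_union]
  rw [h, h]
  ext d
  constructor
  · rintro ⟨p, rfl⟩
    exact ⟨σ p, (aeval_pair_algEquiv σ u v p).symm⟩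
  · rintro ⟨p, rfl⟩
    refine ⟨σ.symm p, ?_⟩
    have := aeval_pair_algEquiv σ u v (σ.symm p)
    rwa [AlgEquiv.apply_symm_apply] at this

theorem adjoin_generators : Algebra.adjoin k
    (Set.range (xA k m r F) ∪ {yA k m r F, zA k m r F, tA k m r F}) = ⊤ := by
  rw [eq_top_iff]
  rintro d -
  obtain ⟨p, rfl⟩ := Ideal.Quotient.mk_surjective d
  have h : Set.range (xA k m r F) ∪ {yA k m r F, zA k m r F, tA k m r F}
      = Set.range (Sum.elim (xA k m r F) ![yA k m r F, zA k m r F, tA k m r F]) := by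
    rw [Set.Sum.elim_range, Matrix.range_cons, Matrix.range_cons, Matrix.range_cons,
      Matrix.range_empty, Set.union_empty, Set.singleton_union, Set.singleton_union]
  rw [h, Algebra.adjoin_range_eq_range_aeval]
  exact ⟨p, (mk_eq_aeval r F p).symm⟩

variable (k m) in
/-- The Laurent variables. -/
def laurentX (l : Fin m) : Laurent k m := .single (Pi.single l 1, 0) 1

variable (k m) in
/-- The polynomial variables. -/
def laurentV (s : Fin 2) : Laurent k m := .single (0, Finsupp.single s 1) 1

theorem prod_laurentX_pow :
    (∏ l, laurentX k m l ^ r l) * .single (fun l => -(r l : ℤ), 0) 1 = 1 := by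
  have h : ∏ l, laurentX k m l ^ r l = .single (fun l => (r l : ℤ), 0) 1 := by
    have h1 : ∀ s : Finset (Fin m), ∏ l ∈ s, laurentX k m l ^ r l
        = .single (fun l => if l ∈ s then (r l : ℤ) else 0, 0) 1 := by
      intro s
      induction s using Finset.induction_on with
      | empty => simp [AddMonoidAlgebra.one_def]; rfl
      | insert l s hl ih =>
        rw [Finset.prod_insert hl, ih, laurentX, AddMonoidAlgebra.single_pow,
          AddMonoidAlgebra.single_mul_single, one_pow, one_mul]
        congr 1
        refine Prod.ext (funext fun j => ?_) (by simp)
        by_cases hj : j = l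
        · subst hj
          simp [hl]
        · simp [hj]
    simpa using h1 Finset.univ
  rw [h, AddMonoidAlgebra.single_mul_single, AddMonoidAlgebra.one_def, one_mul]
  congr 1
  refine Prod.ext (funext fun j => ?_) (by simp)
  simp

/-- The homomorphism from `A` determined by the images of the generators. -/
def liftA {S : Type} [CommRing S] [Algebra k S] (x : Fin m → S) (y u v : S)
    (h : (∏ l, x l ^ r l) * y = aeval (Sum.elim x ![u, v]) F) : RingA k m r F →ₐ[k] S :=
  Ideal.Quotient.liftₐ _ (aeval (Sum.elim x ![y, u, v])) fun p hp => by
    obtain ⟨q, rfl⟩ := Ideal.mem_span_singleton'.mp hp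
    rw [map_mul, aeval_relG, h, sub_self, mul_zero]

theorem liftA_mk {S : Type} [CommRing S] [Algebra k S] (x : Fin m → S) (y u v : S)
    (h : (∏ l, x l ^ r l) * y = aeval (Sum.elim x ![u, v]) F) (p : BigP k m) :
    liftA r F x y u v h (Ideal.Quotient.mk _ p) = aeval (Sum.elim x ![y, u, v]) p :=
  rfl

theorem liftA_aeval {S : Type} [CommRing S] [Algebra k S] (x : Fin m → S) (y u v : S)
    (h : (∏ l, x l ^ r l) * y = aeval (Sum.elim x ![u, v]) F) (p : MvPolynomial (Fin 2) k) :
    liftA r F x y u v h (aeval ![zA k m r F, tA k m r F] p) = aeval ![u, v] p := by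
  have h1 : (liftA r F x y u v h).comp (aeval ![zA k m r F, tA k m r F])
      = aeval (R := k) ![u, v] := by
    ext s
    fin_cases s
    · simp [zA, liftA_mk]
    · simp [tA, liftA_mk]
  exact DFunLike.congr_fun h1 p

/-- The presentation of `A` obtained from a change of the variables `z` and `t`. -/
def presentation : LaurentPresentation k (RingA k m r F) r (changeVars F σ) where
  x := xA k m r F
  y := yA k m r F
  z := aeval ![zA k m r F, tA k m r F] (σ (X 0))
  t := aeval ![zA k m r F, tA k m r F] (σ (X 1))
  rel := by rw [aeval_changeVars, relA]
  adjoin_eq_top := by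
    rw [← adjoin_generators r F, ← Set.union_singleton, ← Set.union_singleton (a := yA k m r F),
      ← Set.union_assoc, ← Set.union_assoc]
    simp only [Algebra.adjoin_union, adjoin_pair_eq]
  ι := liftA r F (laurentX k m) (.single (fun l => -(r l : ℤ), 0) 1 *
      aeval (Sum.elim (laurentX k m) ![aeval ![laurentV k m 0, laurentV k m 1] (σ.symm (X 0)),
        aeval ![laurentV k m 0, laurentV k m 1] (σ.symm (X 1))]) F)
    (aeval ![laurentV k m 0, laurentV k m 1] (σ.symm (X 0)))
    (aeval ![laurentV k m 0, laurentV k m 1] (σ.symm (X 1)))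
    (by rw [← mul_assoc, prod_laurentX_pow, one_mul])
  ι_x l := by rw [xA, liftA_mk, aeval_X, Sum.elim_inl, laurentX]
  ι_z := by
    rw [liftA_aeval, aeval_pair_algEquiv, AlgEquiv.symm_apply_apply, aeval_X]
    rfl
  ι_t := by
    rw [liftA_aeval, aeval_pair_algEquiv, AlgEquiv.symm_apply_apply, aeval_X]
    rfl

theorem adjoin_presentation : Algebra.adjoin k (Set.range (presentation r F σ).x ∪
    {(presentation r F σ).z, (presentation r F σ).t}) = BA k m r F := by
  rw [BA, Algebra.adjoin_union, Algebra.adjoin_union]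
  congr 1
  exact adjoin_pair_eq σ _ _

theorem exists_invariant_notMem_BA (h : BA k m r F < Derksen k (RingA k m r F)) :
    ∃ φ : ExpMap k (RingA k m r F), φ.invariants ≠ ⊤ ∧ ∃ d ∈ φ.invariants, d ∉ BA k m r F := by
  by_contra! hall
  refine h.not_ge (Algebra.adjoin_le ?_)
  exact Set.iUnion₂_subset fun φ hφ d hd => hall φ hφ d hd

/-- The leading part of `σ⁻¹ f` does not vanish at points with nonzero coordinates. -/
theorem aeval_leadingPart_ne_zero (hr : ∀ l, 1 < r l)
    (h : BA k m r F < Derksen k (RingA k m r F)) {a b wf : ℕ}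
    (hwf : ∀ d ∈ (σ.symm (fOf k m F)).support, Finsupp.weight ![a, b] d ≤ wf)
    (hf : weightedHomogeneousComponent ![a, b] wf (σ.symm (fOf k m F)) ≠ 0)
    (ha : 2 ≤ a) (hb : 2 ≤ b) (hab : a.Coprime b) {α β : k} (hα : α ≠ 0) (hβ : β ≠ 0) :
    aeval ![α, β] (weightedHomogeneousComponent ![a, b] wf (σ.symm (fOf k m F))) ≠ 0 := by
  obtain ⟨φ, hφ, d, hd, hdB⟩ := exists_invariant_notMem_BA r F h
  rw [← fOf_changeVars] at hwf hf ⊢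
  refine (presentation r F σ).aeval_weightedHomogeneousComponent_ne_zero hr hφ hd ?_ hwf hf ha hb
    hab hα hβ
  rwa [adjoin_presentation]

end Presentation

/-! ### Lines in the plane -/

section Lines
variable {k : Type} [Field k]

/-- The automorphism fixing the first variable and adding `P` of it to the second one. -/
def shear (P : Polynomial k) : MvPolynomial (Fin 2) k ≃ₐ[k] MvPolynomial (Fin 2) k :=
  AlgEquiv.ofAlgHom (aeval ![X 0, X 1 + Polynomial.aeval (X 0) P])
    (aeval ![X 0, X 1 - Polynomial.aeval (X 0) P])
    (by
      ext1 s
      fin_cases s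
      · simp
      · simp [← Polynomial.aeval_algHom_apply])
    (by
      ext1 s
      fin_cases s
      · simp
      · simp [← Polynomial.aeval_algHom_apply])

theorem shear_X_zero (P : Polynomial k) : shear P (X 0) = X 0 := by
  simp [shear]

theorem shear_X_one (P : Polynomial k) :
    shear P (X 1) = X 1 + Polynomial.aeval (X 0) P := by
  simp [shear]

variable (k) in
/-- The automorphism exchanging the two variables. -/
def swapVars : MvPolynomial (Fin 2) k ≃ₐ[k] MvPolynomial (Fin 2) k :=
  renameEquiv k (Equiv.swap 0 1)

theorem nonempty_algEquiv_adjoin (σ : MvPolynomial (Fin 2) k ≃ₐ[k] MvPolynomial (Fin 2) k)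
    {S : Subalgebra k (MvPolynomial (Fin 2) k)} (hS : S = Algebra.adjoin k {σ (X 1)}) :
    Nonempty (Polynomial S ≃ₐ[S] MvPolynomial (Fin 2) k) := by
  have hind : AlgebraicIndependent k fun s => σ (X s) :=
    (algebraicIndependent_X (Fin 2) k).map' (f := σ.toAlgHom) σ.injective
  have h1 := hind.transcendental_adjoin (s := {1}) (i := 0) (by simp)
  rw [Set.image_singleton, ← hS] at h1
  have hmem : σ (X 1) ∈ S := hS ▸ Algebra.self_mem_adjoin_singleton k _
  refine ⟨AlgEquiv.ofBijective (Polynomial.aeval (σ (X 0)))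
    ⟨transcendental_iff_injective.mp h1, fun p => ?_⟩⟩
  obtain ⟨q, rfl⟩ := σ.surjective p
  induction q using MvPolynomial.induction_on with
  | C c =>
    refine ⟨Polynomial.C (algebraMap k _ c), ?_⟩
    rw [Polynomial.aeval_C, ← MvPolynomial.algebraMap_eq, AlgEquiv.commutes]
    rfl
  | add p q hp hq =>
    obtain ⟨p', hp⟩ := hp
    obtain ⟨q', hq⟩ := hq
    exact ⟨p' + q', by rw [map_add, hp, hq, map_add]⟩
  | mul_X p s hp =>
    obtain ⟨p', hp⟩ := hp
    fin_cases s
    · exact ⟨p' * Polynomial.X, by rw [map_mul, hp, Polynomial.aeval_X, map_mul]; rfl⟩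
    · refine ⟨p' * Polynomial.C ⟨σ (X 1), hmem⟩, ?_⟩
      rw [map_mul, hp, Polynomial.aeval_C, map_mul]
      rfl

theorem adjoin_singleton_eq_of_associated {f g : MvPolynomial (Fin 2) k} (h : Associated f g) :
    Algebra.adjoin k {f} = Algebra.adjoin k {g} := by
  have key : ∀ {f g : MvPolynomial (Fin 2) k}, Associated f g →
      Algebra.adjoin k {f} ≤ Algebra.adjoin k {g} := by
    intro f g h
    obtain ⟨u, rfl⟩ := h.symm
    obtain ⟨c, -, hc⟩ := MvPolynomial.isUnit_iff_eq_C_of_isReduced.mp u.isUnit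
    refine Algebra.adjoin_le (Set.singleton_subset_iff.mpr ?_)
    rw [hc]
    exact mul_mem (Algebra.self_mem_adjoin_singleton k _) (Subalgebra.algebraMap_mem _ c)
  exact (key h).antisymm (key h.symm)

theorem nonempty_algEquiv_of_dvd {f : MvPolynomial (Fin 2) k} (hf : ¬ IsUnit f)
    {σ : MvPolynomial (Fin 2) k ≃ₐ[k] MvPolynomial (Fin 2) k} (h : f ∣ σ (X 1)) :
    Nonempty (Polynomial ↥(Algebra.adjoin k {f})
      ≃ₐ[↥(Algebra.adjoin k {f})] MvPolynomial (Fin 2) k) := by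
  have h1 : Irreducible (σ (X 1)) :=
    (MulEquiv.irreducible_iff σ).mpr (X_prime (i := (1 : Fin 2))).irreducible
  exact nonempty_algEquiv_adjoin σ
    (adjoin_singleton_eq_of_associated ((h1.dvd_iff.mp h).resolve_left hf).symm)

/-- The coefficient of a polynomial expression in two polynomials at the largest possible degree. -/
theorem coeff_aeval_pair {g : MvPolynomial (Fin 2) k} {a b wf n : ℕ} (hn : 0 < n)
    (hg : ∀ d ∈ g.support, Finsupp.weight ![a, b] d ≤ wf) {p q : Polynomial k}
    (hp : p.natDegree ≤ n * a) (hq : q.natDegree ≤ n * b) :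
    (aeval ![p, q] g).coeff (n * wf)
      = aeval ![p.coeff (n * a), q.coeff (n * b)] (weightedHomogeneousComponent ![a, b] wf g) := by
  classical
  have hmon : ∀ d ∈ g.support, (aeval ![p, q] (monomial d (g.coeff d))).coeff (n * wf)
      = aeval ![p.coeff (n * a), q.coeff (n * b)]
        (weightedHomogeneousComponent ![a, b] wf (monomial d (g.coeff d))) := by
    intro d hd
    have hp' : (p ^ d 0).natDegree ≤ d 0 * (n * a) := Polynomial.natDegree_pow_le_of_le _ hp
    have hq' : (q ^ d 1).natDegree ≤ d 1 * (n * b) := Polynomial.natDegree_pow_le_of_le _ hq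
    have hw : n * Finsupp.weight ![a, b] d = d 0 * (n * a) + d 1 * (n * b) := by
      rw [weight_pair]
      ring
    rw [aeval_monomial, Finsupp.prod_fintype _ _ fun _ => pow_zero _, Fin.prod_univ_two,
      Polynomial.algebraMap_eq, Polynomial.coeff_C_mul]
    change g.coeff d * (p ^ d 0 * q ^ d 1).coeff _ = _
    by_cases h : Finsupp.weight ![a, b] d = wf
    · rw [(isWeightedHomogeneous_monomial _ _ _ h).weightedHomogeneousComponent_same, ← h, hw,
        Polynomial.coeff_mul_add_eq_of_natDegree_le hp' hq',
        Polynomial.coeff_pow_of_natDegree_le hp, Polynomial.coeff_pow_of_natDegree_le hq,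
        aeval_monomial, Finsupp.prod_fintype _ _ fun _ => pow_zero _, Fin.prod_univ_two]
      rfl
    · rw [(isWeightedHomogeneous_monomial _ _ _ rfl).weightedHomogeneousComponent_ne _ (Ne.symm h),
        map_zero (aeval _), Polynomial.coeff_eq_zero_of_natDegree_lt, mul_zero]
      refine (Polynomial.natDegree_mul_le_of_le hp' hq').trans_lt ?_
      rw [← hw]
      exact Nat.mul_lt_mul_of_pos_left ((hg d hd).lt_of_ne h) hn
  conv_lhs => rw [g.as_sum]
  conv_rhs => rw [g.as_sum]
  simp only [map_sum, Polynomial.finsetSum_coeff]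
  exact Finset.sum_congr rfl hmon

theorem exists_natDegree_lt {p q : Polynomial k} (hp : 0 < p.natDegree) (hq : 0 < q.natDegree)
    (h : p.natDegree ∣ q.natDegree) :
    ∃ P : Polynomial k, (q + Polynomial.aeval p P).natDegree < q.natDegree := by
  obtain ⟨e, he⟩ := h
  set c := q.leadingCoeff / p.leadingCoeff ^ e with hc
  have hp0 : p.leadingCoeff ≠ 0 := by
    rw [Polynomial.leadingCoeff_ne_zero]
    rintro rfl
    simp at hp
  refine ⟨-Polynomial.monomial e c, ?_⟩
  rw [map_neg, Polynomial.aeval_monomial, ← sub_eq_add_neg, Polynomial.algebraMap_eq]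
  have hdeg : (Polynomial.C c * p ^ e).natDegree ≤ q.natDegree := by
    refine (Polynomial.natDegree_C_mul_le _ _).trans ?_
    rw [he, mul_comm]
    exact Polynomial.natDegree_pow_le
  have hle : (q - Polynomial.C c * p ^ e).natDegree ≤ q.natDegree :=
    (Polynomial.natDegree_sub_le_of_le le_rfl hdeg).trans (max_self _).le
  refine hle.lt_of_ne fun heq => ?_
  have hcoeff : (q - Polynomial.C c * p ^ e).coeff q.natDegree = 0 := by
    have h1 : (p ^ e).coeff q.natDegree = p.leadingCoeff ^ e := by
      rw [he, mul_comm, Polynomial.coeff_pow_of_natDegree_le le_rfl]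
      rfl
    rw [Polynomial.coeff_sub, Polynomial.coeff_C_mul, h1, hc, div_mul_cancel₀ _ (pow_ne_zero _ hp0)]
    exact sub_self _
  rw [← heq] at hcoeff
  have h0 := Polynomial.leadingCoeff_eq_zero.mp hcoeff
  rw [h0, Polynomial.natDegree_zero] at heq
  omega

/-- A line all of whose images under automorphisms have leading parts not vanishing at points with
nonzero coordinates is a coordinate. -/
theorem nonempty_algEquiv_of_line {f : MvPolynomial (Fin 2) k} (hf : f ≠ 0)
    (hline : Nonempty ((MvPolynomial (Fin 2) k ⧸ Ideal.span {f}) ≃ₐ[k] Polynomial k))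
    (H : ∀ (σ : MvPolynomial (Fin 2) k ≃ₐ[k] MvPolynomial (Fin 2) k) (a b wf : ℕ),
      (∀ d ∈ (σ.symm f).support, Finsupp.weight ![a, b] d ≤ wf) →
      weightedHomogeneousComponent ![a, b] wf (σ.symm f) ≠ 0 → 2 ≤ a → 2 ≤ b → a.Coprime b →
      ∀ α β : k, α ≠ 0 → β ≠ 0 →
        aeval ![α, β] (weightedHomogeneousComponent ![a, b] wf (σ.symm f)) ≠ 0) :
    Nonempty (Polynomial ↥(Algebra.adjoin k {f})
      ≃ₐ[↥(Algebra.adjoin k {f})] MvPolynomial (Fin 2) k) := by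
  classical
  obtain ⟨e⟩ := hline
  set π : MvPolynomial (Fin 2) k →ₐ[k] Polynomial k :=
    e.toAlgHom.comp (Ideal.Quotient.mkₐ k (Ideal.span {f})) with hπ
  have hker : ∀ p, π p = 0 ↔ f ∣ p := by
    intro p
    rw [← Ideal.mem_span_singleton, ← Ideal.Quotient.eq_zero_iff_mem]
    exact e.map_eq_zero_iff
  have hunit : ¬ IsUnit f := by
    intro h
    have := (hker 1).mpr h.dvd
    rw [map_one] at this
    exact one_ne_zero this
  set N : (MvPolynomial (Fin 2) k ≃ₐ[k] MvPolynomial (Fin 2) k) → ℕ :=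
    fun σ => (π (σ (X 0))).natDegree + (π (σ (X 1))).natDegree with hN
  have hconst : ∀ σ : MvPolynomial (Fin 2) k ≃ₐ[k] MvPolynomial (Fin 2) k,
      (π (σ (X 1))).natDegree = 0 → Nonempty (Polynomial ↥(Algebra.adjoin k {f})
        ≃ₐ[↥(Algebra.adjoin k {f})] MvPolynomial (Fin 2) k) := by
    intro σ hσ
    rw [Polynomial.natDegree_eq_zero] at hσ
    obtain ⟨c, hc⟩ := hσ
    refine nonempty_algEquiv_of_dvd hunit (σ := (shear (Polynomial.C (-c))).trans σ) ?_
    rw [← hker, AlgEquiv.trans_apply, shear_X_one, map_add, map_add, ← hc, Polynomial.aeval_C,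
      AlgEquiv.commutes, AlgHom.commutes, Polynomial.algebraMap_eq, ← map_add, add_neg_cancel,
      map_zero]
  have hlower : ∀ σ : MvPolynomial (Fin 2) k ≃ₐ[k] MvPolynomial (Fin 2) k,
      0 < (π (σ (X 0))).natDegree → 0 < (π (σ (X 1))).natDegree →
      (π (σ (X 0))).natDegree ∣ (π (σ (X 1))).natDegree → ∃ σ', N σ' < N σ := by
    intro σ h0 h1 hdvd
    obtain ⟨P, hP⟩ := exists_natDegree_lt h0 h1 hdvd
    refine ⟨(shear P).trans σ, ?_⟩
    simp only [hN, AlgEquiv.trans_apply, shear_X_zero, shear_X_one, map_add,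
      ← Polynomial.aeval_algHom_apply]
    exact Nat.add_lt_add_left hP _
  obtain ⟨σ, hσ⟩ : ∃ σ, ∀ σ', N σ ≤ N σ' :=
    ⟨Function.argmin N, fun σ' => Function.argmin_le N σ'⟩
  have hswap : ∀ s, (swapVars k).trans σ (X s) = σ (X (Equiv.swap 0 1 s)) := by
    intro s
    simp [swapVars]
  rcases Nat.eq_zero_or_pos (π (σ (X 1))).natDegree with h1 | h1
  · exact hconst σ h1
  rcases Nat.eq_zero_or_pos (π (σ (X 0))).natDegree with h0 | h0
  · exact hconst ((swapVars k).trans σ) (by rwa [hswap, Equiv.swap_apply_right])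
  have hdvd : ¬ (π (σ (X 0))).natDegree ∣ (π (σ (X 1))).natDegree := fun h => by
    obtain ⟨σ', h'⟩ := hlower σ h0 h1 h
    exact (hσ σ').not_gt h'
  have hdvd' : ¬ (π (σ (X 1))).natDegree ∣ (π (σ (X 0))).natDegree := fun h => by
    obtain ⟨σ', h'⟩ := hlower ((swapVars k).trans σ)
      (by rwa [hswap, Equiv.swap_apply_left]) (by rwa [hswap, Equiv.swap_apply_right])
      (by rwa [hswap, hswap, Equiv.swap_apply_left, Equiv.swap_apply_right])
    refine (hσ σ').not_gt (h'.trans_eq ?_)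
    simp only [hN, hswap, Equiv.swap_apply_left, Equiv.swap_apply_right, add_comm]
  exfalso
  set p := π (σ (X 0)) with hp
  set q := π (σ (X 1)) with hq
  obtain ⟨n, a, b, hn, hab, ha, hb⟩ := Nat.exists_coprime'
    (Nat.gcd_pos_of_pos_left q.natDegree h0)
  have hpair : aeval ![p, q] (σ.symm f) = 0 := by
    have h1 : aeval ![p, q] = π.comp σ.toAlgHom := by
      ext1 s
      fin_cases s <;> simp [hp, hq]
    rw [h1, AlgHom.comp_apply]
    change π (σ (σ.symm f)) = 0
    rw [AlgEquiv.apply_symm_apply]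
    exact (hker f).mpr dvd_rfl
  obtain ⟨d, hd, hmax⟩ := (σ.symm f).support.exists_max_image (Finsupp.weight ![a, b])
    (support_nonempty.mpr (by simpa using hf))
  refine H σ a b (Finsupp.weight ![a, b] d) hmax ?_ ?_ ?_ hab p.leadingCoeff q.leadingCoeff ?_ ?_ ?_
  · intro h
    have := congrArg (coeff d) h
    rw [coeff_weightedHomogeneousComponent, if_pos rfl, coeff_zero] at this
    exact mem_support_iff.mp hd this
  · rw [ha, hb] at hdvd
    rcases a with _ | _ | a
    · omega
    · exact absurd (Nat.mul_dvd_mul_right (one_dvd b) n) hdvd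
    · omega
  · rw [ha, hb] at hdvd'
    rcases b with _ | _ | b
    · omega
    · exact absurd (Nat.mul_dvd_mul_right (one_dvd a) n) hdvd'
    · omega
  · rw [Polynomial.leadingCoeff_ne_zero]
    rintro h
    simp [h] at h0
  · rw [Polynomial.leadingCoeff_ne_zero]
    rintro h
    simp [h] at h1
  · have h := coeff_aeval_pair hn hmax (p := p) (q := q) (by rw [ha, mul_comm])
      (by rw [hb, mul_comm])
    rw [hpair, Polynomial.coeff_zero, mul_comm n a, mul_comm n b, ← ha, ← hb] at h
    exact h.symm

end Lines

/-!
STATEMENT 19 (Proposition `r1`).  Suppose `B ⊊ DK(A)` and `f(Z,T)` is a line in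
`k[Z,T]` (i.e. `k[Z,T]/(f) ≅ k^{[1]}`).  Then `k[Z,T] = k[f]^{[1]}`, i.e. `f` is a
coordinate of `k[Z,T]`.
-/

theorem statement19 (k : Type) [Field k] (m : ℕ) (hm : 1 ≤ m)
    (r : Fin m → ℕ) (hr : ∀ i, 1 < r i)
    (F : MvPolynomial (Fin m ⊕ Fin 2) k) (hf : fOf k m F ≠ 0)
    [IsDomain (RingA k m r F)]
    (hlt : BA k m r F < Derksen k (RingA k m r F))
    (hline : Nonempty ((MvPolynomial (Fin 2) k ⧸ Ideal.span {fOf k m F})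
      ≃ₐ[k] Polynomial k)) :
    Nonempty (Polynomial ↥(Algebra.adjoin k {fOf k m F})
      ≃ₐ[↥(Algebra.adjoin k {fOf k m F})] MvPolynomial (Fin 2) k) := by
  exact nonempty_algEquiv_of_line hf hline fun σ _ _ _ hwf hne ha hb hab _ _ hα hβ =>
    aeval_leadingPart_ne_zero r F σ hr hlt hwf hne ha hb hab hα hβ
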